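/- arXiv:2209.05897 — 2 statements merged into one kernel-verified Lean document; each statement's English description precedes it below -/
import Mathlib

section
/- Let 0 < θ < 1, 0 < q₀, q₁ < ∞, 1 ≤ p₀ < p₁ ≤ ∞, a₀, a₁ ∈ ℝ, and set a = (1−θ)a₀ + θa₁, 1/p = (1−θ)/p₀ + θ/p₁ and 1/q = (1−θ)/q₀ + θ/q₁. Let X₀ = K^{a₀}_{p₀,q₀}(Ω) and X₁ = K^{a₁}_{p₁,q₁}(Ω) be the non-homogeneous Herz spaces. Then, up to equivalence of quasi-norms, the real interpolation space (X₀, X₁)_{θ,q} coincides with the non-homogeneous Lorentz–Herz space HL^{a,q}_{p,q}(Ω): there exist constants 0 < c ≤ C < ∞ such that for every f ∈ X₀ + X₁, c·‖f‖_{HL^{a,q}_{p,q}} ≤ ‖f‖_{(X₀,X₁)_{θ,q}} ≤ C·‖f‖_{HL^{a,q}_{p,q}}. -/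
open MeasureTheory ENNReal Set Filter Topology

noncomputable section

variable {X : Type*}

/-- The decreasing rearrangement `f*` of `f` with respect to `μ` :
`f*(s) = inf {α ≥ 0 : μ({x : |f(x)| > α}) ≤ s}`. -/
def rearr [MeasurableSpace X] (μ : Measure X) (f : X → ℝ) (s : ℝ) : ℝ≥0∞ :=
  sInf {α : ℝ≥0∞ | μ {x | α < ENNReal.ofReal |f x|} ≤ ENNReal.ofReal s}

/-- The averaged (maximal) rearrangement `f**(s) = (1/s)∫_0^s f*(t) dt`. -/
def rearrStar [MeasurableSpace X] (μ : Measure X) (f : X → ℝ) (s : ℝ) : ℝ≥0∞ :=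
  (ENNReal.ofReal s)⁻¹ * ∫⁻ t in Set.Ioc (0 : ℝ) s, rearr μ f t

/-- The Lorentz functional built from a rearrangement-type function `R`:
`(∫_0^∞ (t^{1/p} R(t))^r dt/t)^{1/r}` for `r < ∞`, and `sup_{t>0} t^{1/p} R(t)`
for `r = ∞` (when `p = ∞`, `1/p` is interpreted as `0`, which for `R = f*`
recovers the essential supremum of `|f|`). -/
def lorentzNormOf (R : ℝ → ℝ≥0∞) (p r : ℝ≥0∞) : ℝ≥0∞ :=
  if r = ∞ then ⨆ t : {t : ℝ // 0 < t}, ENNReal.ofReal (t.1 ^ p.toReal⁻¹) * R t.1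
  else (∫⁻ t in Set.Ioi (0 : ℝ),
      (ENNReal.ofReal (t ^ p.toReal⁻¹) * R t) ^ r.toReal / ENNReal.ofReal t) ^ r.toReal⁻¹

/-- The Lorentz quasi-norm `‖f‖_{L^{p,r}}`. -/
def lorentzNorm [MeasurableSpace X] (μ : Measure X) (p r : ℝ≥0∞) (f : X → ℝ) : ℝ≥0∞ :=
  lorentzNormOf (rearr μ f) p r

/-- The Lorentz norm `‖f‖*_{L^{p,r}}`, with `f*` replaced by `f**`. -/
def lorentzNormStar [MeasurableSpace X] (μ : Measure X) (p r : ℝ≥0∞) (f : X → ℝ) : ℝ≥0∞ :=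
  lorentzNormOf (rearrStar μ f) p r

/-- The annuli `A_u`, `u ≥ -1`:  `A_{-1} = {x ∈ Ω : |x| < 1/2}` and, for `u ≥ 0`,
`A_u = {x ∈ Ω : 2^{u-1} ≤ |x| < 2^u}`. -/
def annulus [Norm X] (Ω : Set X) (u : ℤ) : Set X :=
  if u = -1 then {x ∈ Ω | ‖x‖ < 1 / 2}
  else {x ∈ Ω | (2 : ℝ) ^ (u - 1) ≤ ‖x‖ ∧ ‖x‖ < (2 : ℝ) ^ u}

/-- The Herz-type functional built from a functional `L` on the blocks:
`(Σ_{u ≥ -1} (2^{ua} L(f χ_{A_u}))^q)^{1/q}` for `q < ∞`, with the sup-modification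
for `q = ∞`. -/
def herzNormWith {E : Type*} [Norm X] [Zero E] (Ω : Set X) (a : ℝ) (q : ℝ≥0∞)
    (L : (X → E) → ℝ≥0∞) (f : X → E) : ℝ≥0∞ :=
  if q = ∞ then
    ⨆ u : {u : ℤ // -1 ≤ u},
      ENNReal.ofReal ((2 : ℝ) ^ ((u.1 : ℝ) * a)) * L ((annulus Ω u.1).indicator f)
  else (∑' u : {u : ℤ // -1 ≤ u},
      (ENNReal.ofReal ((2 : ℝ) ^ ((u.1 : ℝ) * a)) * L ((annulus Ω u.1).indicator f)) ^ q.toReal)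
      ^ q.toReal⁻¹

/-- The non-homogeneous Lorentz–Herz quasi-norm `‖f‖_{HL^{a,r}_{p,q}}`. -/
def herzNorm [MeasurableSpace X] [Norm X] (μ : Measure X) (Ω : Set X) (a : ℝ)
    (p q r : ℝ≥0∞) (f : X → ℝ) : ℝ≥0∞ :=
  herzNormWith Ω a q (lorentzNorm μ p r) f

/-- The non-homogeneous Lorentz–Herz norm `‖f‖*_{HL^{a,r}_{p,q}}`, built from the
Lorentz norms `‖·‖*_{L^{p,r}}`. -/
def herzNormStar [MeasurableSpace X] [Norm X] (μ : Measure X) (Ω : Set X) (a : ℝ)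
    (p q r : ℝ≥0∞) (f : X → ℝ) : ℝ≥0∞ :=
  herzNormWith Ω a q (lorentzNormStar μ p r) f

/-- The conjugate exponent: `1/p + 1/p' = 1`, with `1' = ∞` and `∞' = 1`. -/
def conjExp (p : ℝ≥0∞) : ℝ≥0∞ :=
  if p = 1 then ∞ else if p = ∞ then 1 else ENNReal.ofReal (p.toReal / (p.toReal - 1))

/-- The quantity `(Σ_{u≥-1} (2^{ua} μ(A_u ∩ E)^{1/p})^q)^{(of the summands)}`,
i.e. `Σ_{u≥-1} 2^{uaq} μ(A_u ∩ E)^{q/p}` for `q < ∞`, with the sup-modification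
for `q = ∞`. -/
def herzSetNorm [MeasurableSpace X] [Norm X] (μ : Measure X) (Ω : Set X) (a : ℝ)
    (p q : ℝ≥0∞) (E : Set X) : ℝ≥0∞ :=
  if q = ∞ then
    ⨆ u : {u : ℤ // -1 ≤ u},
      ENNReal.ofReal ((2 : ℝ) ^ ((u.1 : ℝ) * a)) * μ (annulus Ω u.1 ∩ E) ^ p.toReal⁻¹
  else ∑' u : {u : ℤ // -1 ≤ u},
      (ENNReal.ofReal ((2 : ℝ) ^ ((u.1 : ℝ) * a)) * μ (annulus Ω u.1 ∩ E) ^ p.toReal⁻¹) ^ q.toReal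

/-- The Peetre K-functional for the couple of quasi-normed function spaces
determined by the functionals `n₀`, `n₁`. -/
def Kfun [MeasurableSpace X] (n₀ n₁ : (X → ℝ) → ℝ≥0∞) (t : ℝ) (f : X → ℝ) : ℝ≥0∞ :=
  ⨅ (g : X → ℝ) (_ : Measurable g) (_ : Measurable (f - g)),
    n₀ g + ENNReal.ofReal t * n₁ (f - g)

/-- The real interpolation quasi-norm `‖f‖_{(X₀,X₁)_{θ,q}}`. -/
def interpNorm [MeasurableSpace X] (n₀ n₁ : (X → ℝ) → ℝ≥0∞) (θ : ℝ) (q : ℝ≥0∞)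
    (f : X → ℝ) : ℝ≥0∞ :=
  if q = ∞ then ⨆ t : {t : ℝ // 0 < t}, ENNReal.ofReal (t.1 ^ (-θ)) * Kfun n₀ n₁ t.1 f
  else (∫⁻ t in Set.Ioi (0 : ℝ),
      (ENNReal.ofReal (t ^ (-θ)) * Kfun n₀ n₁ t f) ^ q.toReal / ENNReal.ofReal t) ^ q.toReal⁻¹

/-- Membership in the sum `X₀ + X₁` of the couple determined by `n₀`, `n₁`. -/
def inSum [MeasurableSpace X] (n₀ n₁ : (X → ℝ) → ℝ≥0∞) (f : X → ℝ) : Prop :=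
  ∃ g : X → ℝ, Measurable g ∧ Measurable (f - g) ∧ n₀ g < ∞ ∧ n₁ (f - g) < ∞

end
abbrev Euc (N : ℕ) : Type := EuclideanSpace ℝ (Fin N)


theorem hz_F1 (a : ℝ) (ha : 0 < a) (m : ℝ) (hm : 0 ≤ m) :
    ∫⁻ y in Set.Ioc (0:ℝ) m, ENNReal.ofReal (a * y ^ (a - 1)) = ENNReal.ofReal (m ^ a) := by
  rw [← ofReal_integral_eq_lintegral_ofReal]
  · rw [← intervalIntegral.integral_of_le hm, intervalIntegral.integral_const_mul,
      integral_rpow (Or.inl (by linarith))]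
    congr 1
    rw [sub_add_cancel, Real.zero_rpow ha.ne']
    field_simp
    ring
  · apply Integrable.const_mul
    have := (intervalIntegral.intervalIntegrable_rpow' (a := 0) (b := m) (r := a - 1) (by linarith))
    exact (intervalIntegrable_iff_integrableOn_Ioc_of_le hm).1 this
  · filter_upwards [ae_restrict_mem measurableSet_Ioc] with y hy
    have := Real.rpow_nonneg hy.1.le (a - 1)
    positivity

theorem hz_F2 (g : ℝ) (hg : 0 < g) (m : ℝ) (hm : 0 < m) :
    ∫⁻ y in Set.Ioi m, ENNReal.ofReal (y ^ (-g - 1)) = ENNReal.ofReal (g⁻¹ * m ^ (-g)) := by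
  rw [← ofReal_integral_eq_lintegral_ofReal]
  · rw [integral_Ioi_rpow_of_lt (by linarith) hm]
    congr 1
    rw [sub_add_cancel]
    field_simp
  · exact integrableOn_Ioi_rpow_of_lt (by linarith) hm
  · filter_upwards [ae_restrict_mem measurableSet_Ioi] with y hy
    exact Real.rpow_nonneg (hm.trans hy).le _

theorem hz_L1_lower (a : ℝ) (ha : 0 < a) (M : ℝ≥0∞) :
    M ≤ ∫⁻ y in Set.Ioi (0:ℝ), ENNReal.ofReal (a * y ^ (a - 1)) *
      (if ENNReal.ofReal (y ^ a) < M then 1 else 0) := by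
  apply le_of_forall_lt
  intro r hr
  obtain ⟨r', hr1, hr2⟩ := exists_between hr
  apply hr1.trans_le
  have hfin : r' ≠ ∞ := ne_top_of_lt hr2
  have h0 : 0 ≤ r'.toReal ^ a⁻¹ := Real.rpow_nonneg ENNReal.toReal_nonneg _
  have h1 : ENNReal.ofReal ((r'.toReal ^ a⁻¹) ^ a) = r' := by
    rw [Real.rpow_inv_rpow ENNReal.toReal_nonneg ha.ne', ENNReal.ofReal_toReal hfin]
  calc r' = ∫⁻ y in Set.Ioc (0:ℝ) (r'.toReal ^ a⁻¹), ENNReal.ofReal (a * y ^ (a - 1)) := by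
        rw [hz_F1 a ha _ h0, h1]
    _ ≤ ∫⁻ y in Set.Ioc (0:ℝ) (r'.toReal ^ a⁻¹), ENNReal.ofReal (a * y ^ (a - 1)) *
      (if ENNReal.ofReal (y ^ a) < M then 1 else 0) := by
        apply setLIntegral_mono' measurableSet_Ioc
        intro y hy
        rw [if_pos, mul_one]
        refine lt_of_le_of_lt ?_ hr2
        rw [← h1]
        exact ENNReal.ofReal_le_ofReal (Real.rpow_le_rpow hy.1.le hy.2 ha.le)
    _ ≤ _ := lintegral_mono_set (fun y hy => hy.1)

theorem hz_L1_upper (a : ℝ) (ha : 0 < a) (M : ℝ≥0∞) :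
    ∫⁻ y in Set.Ioi (0:ℝ), ENNReal.ofReal (a * y ^ (a - 1)) *
      (if ENNReal.ofReal (y ^ a) ≤ M then 1 else 0) ≤ M := by
  rcases eq_or_ne M ∞ with rfl | hfin
  · exact le_top
  have h0 : 0 ≤ M.toReal ^ a⁻¹ := Real.rpow_nonneg ENNReal.toReal_nonneg _
  have h1 : ENNReal.ofReal ((M.toReal ^ a⁻¹) ^ a) = M := by
    rw [Real.rpow_inv_rpow ENNReal.toReal_nonneg ha.ne', ENNReal.ofReal_toReal hfin]
  calc _ ≤ ∫⁻ y in Set.Ioi (0:ℝ), (Set.Ioc (0:ℝ) (M.toReal ^ a⁻¹)).indicator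
        (fun y => ENNReal.ofReal (a * y ^ (a - 1))) y := by
        apply setLIntegral_mono' measurableSet_Ioi
        intro y hy
        split_ifs with h
        · rw [Set.indicator_of_mem, mul_one]
          refine ⟨hy, ?_⟩
          rw [← h1] at h
          have := (ENNReal.ofReal_le_ofReal_iff (Real.rpow_nonneg h0 _)).1 h
          exact (Real.rpow_le_rpow_iff (le_of_lt hy) h0 ha).1 this
        · simp
    _ ≤ ∫⁻ y, (Set.Ioc (0:ℝ) (M.toReal ^ a⁻¹)).indicator
        (fun y => ENNReal.ofReal (a * y ^ (a - 1))) y := setLIntegral_le_lintegral _ _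
    _ = M := by rw [lintegral_indicator measurableSet_Ioc, hz_F1 a ha _ h0, h1]

theorem hz_L2_aux (c g : ℝ) (hc : 0 < c) (D : ℝ) (hD : 0 < D) :
    ENNReal.ofReal (g⁻¹ * (D ^ (-c⁻¹)) ^ (-g)) =
      ENNReal.ofReal g⁻¹ * (ENNReal.ofReal D) ^ (g / c) := by
  rw [ENNReal.ofReal_rpow_of_pos hD, ← Real.rpow_mul hD.le,
    ENNReal.ofReal_mul' (Real.rpow_nonneg hD.le _)]
  congr 3
  field_simp

theorem hz_L2_lower_fin (c g : ℝ) (hc : 0 < c) (hg : 0 < g) (E : ℝ≥0∞) (D : ℝ) (hD : 0 < D)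
    (hDE : ENNReal.ofReal D ≤ E) :
    ENNReal.ofReal g⁻¹ * (ENNReal.ofReal D) ^ (g / c) ≤
    ∫⁻ t in Set.Ioi (0:ℝ), ENNReal.ofReal (t ^ (-g - 1)) *
      (if 1 < ENNReal.ofReal (t ^ c) * E then 1 else 0) := by
  have hm : 0 < D ^ (-c⁻¹) := Real.rpow_pos_of_pos hD _
  rw [← hz_L2_aux c g hc D hD, ← hz_F2 g hg _ hm]
  calc _ ≤ ∫⁻ t in Set.Ioi (D ^ (-c⁻¹)), ENNReal.ofReal (t ^ (-g - 1)) *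
      (if 1 < ENNReal.ofReal (t ^ c) * E then 1 else 0) := by
        apply setLIntegral_mono' measurableSet_Ioi
        intro t ht
        rw [if_pos, mul_one]
        refine lt_of_lt_of_le ?_ (mul_le_mul_right hDE _)
        have htp : 0 < t := hm.trans ht
        rw [← ENNReal.ofReal_mul (Real.rpow_nonneg htp.le _), ← ENNReal.ofReal_one]
        rw [ENNReal.ofReal_lt_ofReal_iff (by positivity)]
        have h3 : (D ^ (-c⁻¹)) ^ c < t ^ c := Real.rpow_lt_rpow hm.le ht hc
        rw [← Real.rpow_mul hD.le, neg_mul, inv_mul_cancel₀ hc.ne', Real.rpow_neg_one] at h3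
        calc 1 = D⁻¹ * D := by field_simp
          _ < _ := by gcongr
    _ ≤ _ := lintegral_mono_set (fun y hy => hm.trans hy)

theorem hz_L2_lower (c g : ℝ) (hc : 0 < c) (hg : 0 < g) (E : ℝ≥0∞) :
    ENNReal.ofReal g⁻¹ * E ^ (g / c) ≤
    ∫⁻ t in Set.Ioi (0:ℝ), ENNReal.ofReal (t ^ (-g - 1)) *
      (if 1 < ENNReal.ofReal (t ^ c) * E then 1 else 0) := by
  rcases eq_or_ne E ∞ with rfl | hfin
  · refine le_trans le_top ?_
    apply le_of_forall_lt
    intro r hr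
    have hgc : 0 < g / c := by positivity
    have hr1 : (0:ℝ) < g * (r.toReal + 1) := by have := @ENNReal.toReal_nonneg r; positivity
    have := hz_L2_lower_fin c g hc hg ∞ ((g * (r.toReal + 1)) ^ (g / c)⁻¹)
      (Real.rpow_pos_of_pos hr1 _) le_top
    refine lt_of_lt_of_le ?_ this
    rw [ENNReal.ofReal_rpow_of_pos (Real.rpow_pos_of_pos hr1 _),
      Real.rpow_inv_rpow hr1.le hgc.ne', ← ENNReal.ofReal_mul (by positivity),
      inv_mul_cancel_left₀ hg.ne']
    rw [ENNReal.lt_ofReal_iff_toReal_lt hr.ne]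
    linarith
  rcases eq_or_ne E 0 with rfl | h0
  · rw [ENNReal.zero_rpow_of_pos (by positivity)]; simp
  have := hz_L2_lower_fin c g hc hg E E.toReal (ENNReal.toReal_pos h0 hfin)
    (by rw [ENNReal.ofReal_toReal hfin])
  rwa [ENNReal.ofReal_toReal hfin] at this

theorem hz_L2_upper (c g : ℝ) (hc : 0 < c) (hg : 0 < g) (E : ℝ≥0∞) :
    ∫⁻ t in Set.Ioi (0:ℝ), ENNReal.ofReal (t ^ (-g - 1)) *
      (if 1 ≤ ENNReal.ofReal (t ^ c) * E then 1 else 0) ≤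
      ENNReal.ofReal g⁻¹ * E ^ (g / c) := by
  rcases eq_or_ne E ∞ with rfl | hfin
  · rw [ENNReal.top_rpow_of_pos (by positivity), ENNReal.mul_top]
    · exact le_top
    · simpa using hg
  rcases eq_or_ne E 0 with rfl | h0
  · simp
  have hD := ENNReal.toReal_pos h0 hfin
  set D := E.toReal with hDdef
  have hE : E = ENNReal.ofReal D := (ENNReal.ofReal_toReal hfin).symm
  have hm : 0 < D ^ (-c⁻¹) := Real.rpow_pos_of_pos hD _
  rw [hE, ← hz_L2_aux c g hc D hD, ← hz_F2 g hg _ hm]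
  calc _ ≤ ∫⁻ t in Set.Ioi (0:ℝ), (Set.Ici (D ^ (-c⁻¹))).indicator
        (fun t => ENNReal.ofReal (t ^ (-g - 1))) t := by
        apply setLIntegral_mono' measurableSet_Ioi
        intro t ht
        have htp : 0 < t := ht
        split_ifs with h
        · rw [Set.indicator_of_mem, mul_one]
          rw [← ENNReal.ofReal_mul (Real.rpow_nonneg htp.le _), ← ENNReal.ofReal_one,
            ENNReal.ofReal_le_ofReal_iff (by positivity)] at h
          rw [Set.mem_Ici, ← Real.rpow_le_rpow_iff hm.le htp.le hc,
            ← Real.rpow_mul hD.le, neg_mul, inv_mul_cancel₀ hc.ne', Real.rpow_neg_one]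
          rwa [inv_le_iff_one_le_mul₀ hD]
        · simp
    _ ≤ ∫⁻ t, (Set.Ici (D ^ (-c⁻¹))).indicator
        (fun t => ENNReal.ofReal (t ^ (-g - 1))) t := setLIntegral_le_lintegral _ _
    _ = _ := by
        rw [lintegral_indicator measurableSet_Ici]
        exact setLIntegral_congr Ioi_ae_eq_Ici.symm

noncomputable def hzPhi {ι : Type*} (x0 x1 : ι → ℝ≥0∞) (y : ℝ) : ℝ≥0∞ :=
  ⨅ i, ⨅ (_ : x0 i ≤ ENNReal.ofReal y), x1 i

noncomputable def hzJ {ι : Type*} (x0 x1 : ι → ℝ≥0∞) (A B : ℝ) : ℝ≥0∞ :=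
  ∫⁻ y in Set.Ioi (0:ℝ), ENNReal.ofReal (y ^ (A - 1)) * hzPhi x0 x1 y ^ B

noncomputable def hzM {ι : Type*} (x0 x1 : ι → ℝ≥0∞) (a b c t : ℝ) : ℝ≥0∞ :=
  ⨅ i, max (x0 i ^ a) (ENNReal.ofReal (t ^ c) * x1 i ^ b)

theorem hzPhi_antitone {ι : Type*} (x0 x1 : ι → ℝ≥0∞) : Antitone (hzPhi x0 x1) := by
  intro y z hyz
  refine le_iInf₂ fun i hi => ?_
  exact iInf₂_le i (hi.trans (ENNReal.ofReal_le_ofReal hyz))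

theorem hz_cond1 {ι : Type*} (x0 x1 : ι → ℝ≥0∞) (a b c : ℝ) (ha : 0 < a) (hb : 0 < b)
    (t y : ℝ) (ht : 0 < t) (hy : 0 < y)
    (h : ENNReal.ofReal (y ^ a) < hzM x0 x1 a b c t) :
    1 ≤ ENNReal.ofReal (t ^ c) * (hzPhi x0 x1 y ^ b / ENNReal.ofReal (y ^ a)) := by
  have hya : 0 < y ^ a := Real.rpow_pos_of_pos hy _
  have htc : 0 < t ^ c := Real.rpow_pos_of_pos ht _
  have h1 : ENNReal.ofReal (y ^ a) / ENNReal.ofReal (t ^ c) ≤ hzPhi x0 x1 y ^ b := by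
    rw [← ENNReal.rpow_inv_le_iff hb]
    refine le_iInf₂ fun i hi => ?_
    rw [ENNReal.rpow_inv_le_iff hb]
    apply ENNReal.div_le_of_le_mul'
    have h2 : ENNReal.ofReal (y ^ a) < max (x0 i ^ a) (ENNReal.ofReal (t ^ c) * x1 i ^ b) :=
      h.trans_le (iInf_le _ i)
    rcases lt_max_iff.1 h2 with h3 | h3
    · exfalso
      rw [← ENNReal.ofReal_rpow_of_pos hy] at h3
      exact absurd h3 (not_lt.2 (ENNReal.rpow_le_rpow hi ha.le))
    · exact h3.le
  rw [← mul_div_assoc, ENNReal.le_div_iff_mul_le (by simp [hya]) (by simp), one_mul]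
  rw [mul_comm]
  exact (ENNReal.div_le_iff_le_mul (by simp [htc]) (by simp)).1 h1

theorem hz_cond2 {ι : Type*} (x0 x1 : ι → ℝ≥0∞) (a b c : ℝ) (ha : 0 < a) (hb : 0 < b)
    (t y : ℝ) (hy : 0 < y)
    (h : 1 < ENNReal.ofReal (t ^ c) * (hzPhi x0 x1 y ^ b / ENNReal.ofReal (y ^ a))) :
    ENNReal.ofReal (y ^ a) ≤ hzM x0 x1 a b c t := by
  have hya : 0 < y ^ a := Real.rpow_pos_of_pos hy _
  have h' := h.le
  rw [← mul_div_assoc, ENNReal.le_div_iff_mul_le (by simp [hya]) (by simp), one_mul] at h'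
  refine le_iInf fun i => ?_
  rcases le_total (x0 i) (ENNReal.ofReal y) with hi | hi
  · refine le_trans h' (le_trans ?_ (le_max_right _ _))
    gcongr
    exact iInf₂_le i hi
  · refine le_trans ?_ (le_max_left _ _)
    rw [← ENNReal.ofReal_rpow_of_pos hy]
    exact ENNReal.rpow_le_rpow hi ha.le

theorem hz_swap (w1 w2 : ℝ → ℝ≥0∞) (k : ℝ → ℝ → ℝ≥0∞)
    (h1 : Measurable w1) (h2 : Measurable w2) (hk : Measurable (Function.uncurry k)) :
    ∫⁻ t in Set.Ioi (0:ℝ), w1 t * ∫⁻ y in Set.Ioi (0:ℝ), w2 y * k t y =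
    ∫⁻ y in Set.Ioi (0:ℝ), w2 y * ∫⁻ t in Set.Ioi (0:ℝ), w1 t * k t y := by
  have e1 : ∀ t, w1 t * ∫⁻ y in Set.Ioi (0:ℝ), w2 y * k t y =
      ∫⁻ y in Set.Ioi (0:ℝ), w1 t * (w2 y * k t y) := fun t => by
    rw [lintegral_const_mul]
    exact h2.mul (hk.comp measurable_prodMk_left)
  have e2 : ∀ y, w2 y * ∫⁻ t in Set.Ioi (0:ℝ), w1 t * k t y =
      ∫⁻ t in Set.Ioi (0:ℝ), w1 t * (w2 y * k t y) := fun y => by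
    rw [← lintegral_const_mul]
    · congr 1; ext t; ring
    exact h1.mul (hk.comp measurable_prodMk_right)
  simp_rw [e1, e2]
  apply lintegral_lintegral_swap
  apply Measurable.aemeasurable
  exact (h1.comp measurable_fst).mul ((h2.comp measurable_snd).mul hk)

theorem hz_rhs {ι : Type*} (x0 x1 : ι → ℝ≥0∞) (a b c g : ℝ) (ha : 0 < a)
    (hc : 0 < c) (hg : 0 < g) :
    ∫⁻ y in Set.Ioi (0:ℝ), ENNReal.ofReal (a * y ^ (a - 1)) *
      (ENNReal.ofReal g⁻¹ * (hzPhi x0 x1 y ^ b / ENNReal.ofReal (y ^ a)) ^ (g / c)) =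
    ENNReal.ofReal (a / g) * hzJ x0 x1 (a * (1 - g / c)) (b * g / c) := by
  unfold hzJ
  rw [← lintegral_const_mul']
  swap
  · simp
  apply setLIntegral_congr_fun measurableSet_Ioi
  intro y hy
  have hy : 0 < y := hy
  have hya : 0 < y ^ a := Real.rpow_pos_of_pos hy _
  have hgc : 0 ≤ g / c := by positivity
  simp only
  rw [ENNReal.div_rpow_of_nonneg _ _ hgc, ← ENNReal.rpow_mul, ← mul_div_assoc b g c,
    ENNReal.ofReal_rpow_of_pos hya, div_eq_mul_inv,
    ← ENNReal.ofReal_inv_of_pos (Real.rpow_pos_of_pos hya _)]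
  have : a * y ^ (a - 1) * g⁻¹ * ((y ^ a) ^ (g / c))⁻¹ = a / g * y ^ (a * (1 - g / c) - 1) := by
    rw [← Real.rpow_mul hy.le, ← Real.rpow_neg hy.le]
    have : a * (1 - g / c) - 1 = (a - 1) + -(a * (g / c)) := by ring
    rw [this, Real.rpow_add hy]
    ring
  rw [← mul_assoc (ENNReal.ofReal (a / g)), ← ENNReal.ofReal_mul (by positivity), ← this,
    ENNReal.ofReal_mul (p := a * y ^ (a - 1) * g⁻¹) (by positivity),
    ENNReal.ofReal_mul (p := a * y ^ (a - 1)) (by positivity)]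
  ring

theorem hzM_mono {ι : Type*} (x0 x1 : ι → ℝ≥0∞) (a b c : ℝ) (hc : 0 ≤ c) :
    MonotoneOn (hzM x0 x1 a b c) (Set.Ioi 0) := by
  intro s hs t ht hst
  refine iInf_mono fun i => ?_
  have hs : 0 < s := hs
  gcongr

theorem hz_power {ι : Type*} (x0 x1 : ι → ℝ≥0∞) (a b c g : ℝ) (ha : 0 < a) (hb : 0 < b)
    (hc : 0 < c) (hg : 0 < g) :
    ∫⁻ t in Set.Ioi (0:ℝ), ENNReal.ofReal (t ^ (-g - 1)) * hzM x0 x1 a b c t =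
    ENNReal.ofReal (a / g) * hzJ x0 x1 (a * (1 - g / c)) (b * g / c) := by
  have hPhi : Measurable (hzPhi x0 x1) := (hzPhi_antitone x0 x1).measurable
  have hw1 : Measurable (fun t : ℝ => ENNReal.ofReal (t ^ (-g - 1))) := by fun_prop
  have hw2 : Measurable (fun y : ℝ => ENNReal.ofReal (a * y ^ (a - 1))) := by fun_prop
  have hD : Measurable (fun z : ℝ × ℝ => ENNReal.ofReal (z.1 ^ c) *
      (hzPhi x0 x1 z.2 ^ b / ENNReal.ofReal (z.2 ^ a))) := by
    have : Measurable (fun z : ℝ × ℝ => hzPhi x0 x1 z.2) := hPhi.comp measurable_snd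
    refine Measurable.mul (by fun_prop) (Measurable.div ?_ (by fun_prop))
    exact this.pow_const b
  rw [← hz_rhs x0 x1 a b c g ha hc hg]
  apply le_antisymm
  · calc _ ≤ ∫⁻ t in Set.Ioi (0:ℝ), ENNReal.ofReal (t ^ (-g - 1)) *
          ∫⁻ y in Set.Ioi (0:ℝ), ENNReal.ofReal (a * y ^ (a - 1)) *
          (if 1 ≤ ENNReal.ofReal (t ^ c) * (hzPhi x0 x1 y ^ b / ENNReal.ofReal (y ^ a))
            then 1 else 0) := by
          apply setLIntegral_mono' measurableSet_Ioi
          intro t ht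
          gcongr
          refine (hz_L1_lower a ha _).trans ?_
          apply setLIntegral_mono' measurableSet_Ioi
          intro y hy
          gcongr
          split_ifs with h1 h2 h2
          · exact le_rfl
          · exact absurd (hz_cond1 x0 x1 a b c ha hb t y ht hy h1) h2
          · exact zero_le
          · exact le_rfl
      _ = _ := hz_swap _ _ (fun t y => if 1 ≤ ENNReal.ofReal (t ^ c) *
            (hzPhi x0 x1 y ^ b / ENNReal.ofReal (y ^ a)) then 1 else 0) hw1 hw2
            (Measurable.ite (measurableSet_le measurable_const hD) measurable_const
              measurable_const)
      _ ≤ _ := by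
          apply setLIntegral_mono' measurableSet_Ioi
          intro y hy
          gcongr
          exact hz_L2_upper c g hc hg _
  · calc _ ≤ ∫⁻ y in Set.Ioi (0:ℝ), ENNReal.ofReal (a * y ^ (a - 1)) *
          ∫⁻ t in Set.Ioi (0:ℝ), ENNReal.ofReal (t ^ (-g - 1)) *
          (if 1 < ENNReal.ofReal (t ^ c) * (hzPhi x0 x1 y ^ b / ENNReal.ofReal (y ^ a))
            then 1 else 0) := by
          apply setLIntegral_mono' measurableSet_Ioi
          intro y hy
          gcongr
          exact hz_L2_lower c g hc hg _
      _ = _ := (hz_swap _ _ (fun t y => if 1 < ENNReal.ofReal (t ^ c) *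
            (hzPhi x0 x1 y ^ b / ENNReal.ofReal (y ^ a)) then 1 else 0) hw1 hw2
            (Measurable.ite (measurableSet_lt measurable_const hD) measurable_const
              measurable_const)).symm
      _ ≤ _ := by
          apply setLIntegral_mono' measurableSet_Ioi
          intro t ht
          gcongr
          refine le_trans ?_ (hz_L1_upper a ha _)
          apply setLIntegral_mono' measurableSet_Ioi
          intro y hy
          gcongr
          split_ifs with h1 h2 h2
          · exact le_rfl
          · exact absurd (hz_cond2 x0 x1 a b c ha hb t y hy h1) h2
          · exact zero_le
          · exact le_rfl

theorem hz_scale_raw (k : ℝ) (hk : 0 < k) (G : ℝ → ℝ≥0∞) :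
    ∫⁻ t in Set.Ioi (0:ℝ), G t = ENNReal.ofReal k * ∫⁻ t in Set.Ioi (0:ℝ), G (k * t) := by
  have himg : (fun t => k * t) '' Set.Ioi (0:ℝ) = Set.Ioi 0 := by
    ext x
    simp only [Set.mem_image, Set.mem_Ioi]
    constructor
    · rintro ⟨t, ht, rfl⟩; positivity
    · intro hx; exact ⟨x / k, by positivity, by field_simp⟩
  have h := lintegral_image_eq_lintegral_abs_deriv_mul (s := Set.Ioi (0:ℝ)) (f := fun t => k * t)
    (f' := fun _ => k) measurableSet_Ioi
    (fun x _ => by simpa using ((hasDerivAt_id x).const_mul k).hasDerivWithinAt)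
    (fun x _ y _ h => mul_left_cancel₀ hk.ne' h) G
  rw [himg] at h
  rw [h, lintegral_const_mul' _ _ (by simp), abs_of_pos hk]

theorem hz_scale (k : ℝ) (hk : 0 < k) (F : ℝ → ℝ≥0∞) :
    ∫⁻ t in Set.Ioi (0:ℝ), F (k * t) / ENNReal.ofReal t =
      ∫⁻ t in Set.Ioi (0:ℝ), F t / ENNReal.ofReal t := by
  rw [hz_scale_raw k hk (fun t => F t / ENNReal.ofReal t), ← lintegral_const_mul' _ _ (by simp)]
  apply setLIntegral_congr_fun measurableSet_Ioi
  intro t ht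
  have ht : 0 < t := ht
  simp only
  rw [ENNReal.ofReal_mul hk.le, ← mul_div_assoc, ENNReal.mul_div_mul_left _ _ (by simpa) (by simp)]

theorem hzPhi_scale {ι : Type*} (x0 x1 : ι → ℝ≥0∞) (w0 w1 : ℝ) (h0 : 0 < w0) (h1 : 0 < w1)
    (y : ℝ) :
    hzPhi (fun i => ENNReal.ofReal w0 * x0 i) (fun i => ENNReal.ofReal w1 * x1 i) (w0 * y) =
      ENNReal.ofReal w1 * hzPhi x0 x1 y := by
  unfold hzPhi
  rw [ENNReal.mul_iInf_of_ne (by simpa) (by simp)]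
  congr 1; ext i
  rw [ENNReal.mul_iInf_of_ne (by simpa) (by simp)]
  have : ENNReal.ofReal w0 * x0 i ≤ ENNReal.ofReal (w0 * y) ↔ x0 i ≤ ENNReal.ofReal y := by
    rw [ENNReal.ofReal_mul h0.le, ENNReal.mul_le_mul_iff_right (by simpa) (by simp)]
  simp only [this]

theorem hzJ_scale {ι : Type*} (x0 x1 : ι → ℝ≥0∞) (w0 w1 : ℝ) (h0 : 0 < w0) (h1 : 0 < w1)
    (A B : ℝ) (hB : 0 ≤ B) :
    hzJ (fun i => ENNReal.ofReal w0 * x0 i) (fun i => ENNReal.ofReal w1 * x1 i) A B =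
      ENNReal.ofReal (w0 ^ A * w1 ^ B) * hzJ x0 x1 A B := by
  unfold hzJ
  rw [hz_scale_raw w0 h0, ← lintegral_const_mul' _ _ (by simp), ← lintegral_const_mul' _ _ (by simp)]
  apply setLIntegral_congr_fun measurableSet_Ioi
  intro y hy
  have hy : 0 < y := hy
  simp only
  rw [hzPhi_scale x0 x1 w0 w1 h0 h1, ENNReal.mul_rpow_of_nonneg _ _ hB, ENNReal.ofReal_rpow_of_pos h1,
    Real.mul_rpow h0.le hy.le, Real.rpow_sub_one h0.ne', ENNReal.ofReal_mul (by positivity),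
    ENNReal.ofReal_mul (by positivity)]
  have : ENNReal.ofReal w0 * ENNReal.ofReal (w0 ^ A / w0) = ENNReal.ofReal (w0 ^ A) := by
    rw [← ENNReal.ofReal_mul h0.le]; congr 1; field_simp
  rw [← this]
  ring

theorem hz_tsum_pow (B : ℝ≥0∞) (hB : 1 < B) (hB' : B ≠ ∞) (r : ℝ) (hr : 0 < r) :
    ∃ C : ℝ≥0∞, C ≠ ∞ ∧ ∀ x : ℕ → ℝ≥0∞, (∑' k, x k) ^ r ≤ C * ∑' k, B ^ k * x k ^ r := by
  have hB0 : B ≠ 0 := (zero_lt_one.trans hB).ne'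
  refine ⟨((1 - B⁻¹ ^ r⁻¹)⁻¹) ^ r, ?_, fun x => ?_⟩
  · apply ENNReal.rpow_ne_top_of_nonneg hr.le
    rw [ENNReal.inv_ne_top]
    apply (tsub_pos_of_lt _).ne'
    apply ENNReal.rpow_lt_one (by simpa using hB) (by positivity)
  · set S := ∑' k, B ^ k * x k ^ r
    have h : ∀ k, x k ≤ (B⁻¹ ^ r⁻¹) ^ k * S ^ r⁻¹ := by
      intro k
      have h1 : B ^ k * x k ^ r ≤ S := ENNReal.le_tsum k
      have h2 : x k ^ r ≤ B⁻¹ ^ k * S := by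
        calc x k ^ r = B⁻¹ ^ k * (B ^ k * x k ^ r) := by
              rw [← mul_assoc, ← mul_pow, ENNReal.inv_mul_cancel hB0 hB']; simp
          _ ≤ _ := by gcongr
      have h3 := ENNReal.rpow_le_rpow h2 (inv_nonneg.2 hr.le)
      rw [← ENNReal.rpow_mul, mul_inv_cancel₀ hr.ne', ENNReal.rpow_one,
        ENNReal.mul_rpow_of_nonneg _ _ (inv_nonneg.2 hr.le)] at h3
      refine h3.trans (le_of_eq ?_)
      congr 1
      rw [← ENNReal.rpow_natCast, ← ENNReal.rpow_natCast, ← ENNReal.rpow_mul, ← ENNReal.rpow_mul,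
        mul_comm]
    calc (∑' k, x k) ^ r ≤ (∑' k, (B⁻¹ ^ r⁻¹) ^ k * S ^ r⁻¹) ^ r := by
          gcongr with k; exact h k
      _ = ((1 - B⁻¹ ^ r⁻¹)⁻¹ * S ^ r⁻¹) ^ r := by
          rw [ENNReal.tsum_mul_right, ENNReal.tsum_geometric]
      _ = _ := by
          rw [ENNReal.mul_rpow_of_nonneg _ _ hr.le, ← ENNReal.rpow_mul, inv_mul_cancel₀ hr.ne',
            ENNReal.rpow_one]

section rearrangement
variable {X : Type*} [MeasurableSpace X] (μ : Measure X)

theorem hz_rearr_anti (f : X → ℝ) : Antitone (rearr μ f) := by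
  intro s t hst
  exact sInf_le_sInf fun α hα => le_trans hα (ENNReal.ofReal_le_ofReal hst)

theorem hz_rearr_att (f : X → ℝ) (s : ℝ) :
    μ {x | rearr μ f s < ENNReal.ofReal |f x|} ≤ ENNReal.ofReal s := by
  set S := {α : ℝ≥0∞ | μ {x | α < ENNReal.ofReal |f x|} ≤ ENNReal.ofReal s} with hS
  have hne : S.Nonempty := ⟨∞, by simp [hS]⟩
  obtain ⟨u, hu1, hu2, hu3⟩ := exists_seq_tendsto_sInf hne (OrderBot.bddBelow S)
  have hun : {x | rearr μ f s < ENNReal.ofReal |f x|} = ⋃ n, {x | u n < ENNReal.ofReal |f x|} := by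
    ext x
    simp only [Set.mem_ofPred_eq, Set.mem_iUnion]
    constructor
    · intro h
      exact ((hu2.eventually_lt_const h)).exists
    · rintro ⟨n, hn⟩
      exact lt_of_le_of_lt (sInf_le (hu3 n)) hn
  rw [hun]
  have hmono : Monotone (fun n => {x | u n < ENNReal.ofReal |f x|}) := by
    intro m n hmn x hx
    exact lt_of_le_of_lt (hu1 hmn) hx
  exact le_of_tendsto' (tendsto_measure_iUnion_atTop hmono) (fun n => hu3 n)

theorem hz_rearr_le (f : X → ℝ) (s : ℝ) (α : ℝ≥0∞)
    (h : μ {x | α < ENNReal.ofReal |f x|} ≤ ENNReal.ofReal s) : rearr μ f s ≤ α := sInf_le h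

theorem hz_rearr_mono (f g : X → ℝ) (h : ∀ x, |g x| ≤ |f x|) (s : ℝ) :
    rearr μ g s ≤ rearr μ f s := by
  apply hz_rearr_le
  refine le_trans (measure_mono ?_) (hz_rearr_att μ f s)
  intro x hx
  exact lt_of_lt_of_le hx (ENNReal.ofReal_le_ofReal (h x))

theorem hz_rearr_add (f g h : X → ℝ) (hf : ∀ x, |f x| ≤ |g x| + |h x|) (s : ℝ) (hs : 0 ≤ s) :
    rearr μ f (2 * s) ≤ rearr μ g s + rearr μ h s := by
  apply hz_rearr_le
  calc _ ≤ μ ({x | rearr μ g s < ENNReal.ofReal |g x|} ∪ {x | rearr μ h s < ENNReal.ofReal |h x|}) := by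
        apply measure_mono
        intro x hx
        by_contra hcon
        simp only [Set.mem_union, Set.mem_ofPred_eq, not_or, not_lt] at hcon hx
        refine absurd hx (not_lt.2 ?_)
        refine le_trans (ENNReal.ofReal_le_ofReal (hf x)) ?_
        rw [ENNReal.ofReal_add (abs_nonneg _) (abs_nonneg _)]
        exact add_le_add hcon.1 hcon.2
    _ ≤ ENNReal.ofReal s + ENNReal.ofReal s :=
        (measure_union_le _ _).trans (add_le_add (hz_rearr_att μ g s) (hz_rearr_att μ h s))
    _ = _ := by rw [two_mul, ENNReal.ofReal_add hs hs]

/-- truncation -/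
noncomputable def hzClamp (l v : ℝ) : ℝ := max (-l) (min l v)

theorem hzClamp_zero (l : ℝ) (hl : 0 ≤ l) : hzClamp l 0 = 0 := by
  simp [hzClamp, hl]

theorem hzClamp_abs (l v : ℝ) (hl : 0 ≤ l) : |hzClamp l v| ≤ |v| ∧ |hzClamp l v| ≤ l ∧
    |v - hzClamp l v| ≤ |v| ∧ (|v| ≤ l → v - hzClamp l v = 0) := by
  unfold hzClamp
  rcases le_total l v with h1 | h1
  · rw [min_eq_left h1, max_eq_right (by linarith)]
    have hv : 0 ≤ v := hl.trans h1
    rw [abs_of_nonneg hl, abs_of_nonneg hv, abs_of_nonneg (by linarith)]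
    exact ⟨h1, le_rfl, by linarith, fun h => by linarith⟩
  · rw [min_eq_right h1]
    rcases le_total (-l) v with h2 | h2
    · rw [max_eq_right h2]
      simp [abs_le, h1, h2]
    · rw [max_eq_left h2]
      have hv : v ≤ 0 := by linarith
      rw [abs_of_nonpos hv, abs_of_nonpos (by linarith : -l ≤ 0), abs_of_nonpos (by linarith)]
      exact ⟨by linarith, by linarith, by linarith, fun h => by linarith⟩

theorem hz_trunc_g (f : X → ℝ) (τ : ℝ) (hfin : rearr μ f τ ≠ ∞) (s : ℝ) (hs : τ ≤ s) :
    rearr μ (fun x => f x - hzClamp (rearr μ f τ).toReal (f x)) s = 0 := by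
  apply le_antisymm _ zero_le
  apply hz_rearr_le
  refine le_trans (measure_mono ?_) ((hz_rearr_att μ f τ).trans (ENNReal.ofReal_le_ofReal hs))
  intro x hx
  by_contra hcon
  simp only [Set.mem_ofPred_eq, not_lt] at hcon hx
  have h2 : |f x| ≤ (rearr μ f τ).toReal := (ENNReal.ofReal_le_iff_le_toReal hfin).1 hcon
  rw [(hzClamp_abs _ _ ENNReal.toReal_nonneg).2.2.2 h2] at hx
  simp at hx

theorem hz_trunc_h (f : X → ℝ) (τ : ℝ) (hfin : rearr μ f τ ≠ ∞) (s : ℝ) :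
    rearr μ (fun x => hzClamp (rearr μ f τ).toReal (f x)) s ≤ rearr μ f τ := by
  apply hz_rearr_le
  rw [measure_eq_zero_iff_ae_notMem.2]
  · exact zero_le
  · refine Filter.Eventually.of_forall fun x => ?_
    simp only [Set.mem_ofPred_eq, not_lt]
    exact (ENNReal.ofReal_le_iff_le_toReal hfin).2 (hzClamp_abs _ _ ENNReal.toReal_nonneg).2.1

end rearrangement

section lorentz
variable {X : Type*} [MeasurableSpace X] (μ : Measure X)

theorem hz_lor_eq (p : ℝ≥0∞) (hp0 : 0 < p) (hp : p ≠ ∞) (f : X → ℝ) :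
    lorentzNorm μ p p f = (∫⁻ t in Set.Ioi (0:ℝ), rearr μ f t ^ p.toReal) ^ p.toReal⁻¹ := by
  unfold lorentzNorm lorentzNormOf
  rw [if_neg hp]
  congr 1
  have hP : 0 < p.toReal := ENNReal.toReal_pos hp0.ne' hp
  apply setLIntegral_congr_fun measurableSet_Ioi
  intro t ht
  have ht : 0 < t := ht
  simp only
  rw [ENNReal.mul_rpow_of_nonneg _ _ hP.le, ENNReal.ofReal_rpow_of_pos (Real.rpow_pos_of_pos ht _),
    Real.rpow_inv_rpow ht.le hP.ne', mul_comm, ENNReal.mul_div_cancel_right (by simpa) (by simp)]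

theorem hz_lor_top (f : X → ℝ) :
    lorentzNorm μ ∞ ∞ f = ⨆ t : {t : ℝ // 0 < t}, rearr μ f t.1 := by
  unfold lorentzNorm lorentzNormOf
  simp

theorem hz_piece (R : ℝ → ℝ≥0∞) (P : ℝ) (hP : 0 < P) (s : ℝ) (hs : 0 < s) (r : ℝ≥0∞)
    (S : Set ℝ) (hS : MeasurableSet S) (hvol : volume S ≤ ENNReal.ofReal s)
    (hR : ∀ t ∈ S, R t ≤ r) :
    ∫⁻ t in S, R t ^ P ≤ (ENNReal.ofReal (s ^ P⁻¹) * r) ^ P := by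
  calc _ ≤ ∫⁻ t in S, r ^ P := by
        apply setLIntegral_mono' hS
        intro t ht
        exact ENNReal.rpow_le_rpow (hR t ht) hP.le
    _ = r ^ P * volume S := by rw [setLIntegral_const]
    _ ≤ r ^ P * ENNReal.ofReal s := by gcongr
    _ = _ := by
        rw [ENNReal.mul_rpow_of_nonneg _ _ hP.le, ENNReal.ofReal_rpow_of_pos (Real.rpow_pos_of_pos hs _),
          Real.rpow_inv_rpow hs.le hP.ne', mul_comm]

theorem hz_lor_lower (p : ℝ≥0∞) (hp0 : 0 < p) (f : X → ℝ) (τ : ℝ) (hτ : 0 < τ) :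
    ENNReal.ofReal (τ ^ p.toReal⁻¹) * rearr μ f τ ≤ lorentzNorm μ p p f := by
  rcases eq_or_ne p ∞ with rfl | hp
  · rw [hz_lor_top]
    simp only [ENNReal.toReal_top, _root_.inv_zero, Real.rpow_zero, ENNReal.ofReal_one, one_mul]
    exact le_iSup (fun t : {t : ℝ // 0 < t} => rearr μ f t.1) ⟨τ, hτ⟩
  · rw [hz_lor_eq μ p hp0 hp]
    have hP : 0 < p.toReal := ENNReal.toReal_pos hp0.ne' hp
    rw [ENNReal.le_rpow_inv_iff hP]
    calc _ = ENNReal.ofReal τ * rearr μ f τ ^ p.toReal := by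
          rw [ENNReal.mul_rpow_of_nonneg _ _ hP.le,
            ENNReal.ofReal_rpow_of_pos (Real.rpow_pos_of_pos hτ _), Real.rpow_inv_rpow hτ.le hP.ne']
      _ = ∫⁻ t in Set.Ioc 0 τ, rearr μ f τ ^ p.toReal := by
          rw [setLIntegral_const, Real.volume_Ioc, sub_zero, mul_comm]
      _ ≤ ∫⁻ t in Set.Ioc 0 τ, rearr μ f t ^ p.toReal := by
          apply setLIntegral_mono' measurableSet_Ioc
          intro t ht
          exact ENNReal.rpow_le_rpow (hz_rearr_anti μ f ht.2) hP.le
      _ ≤ _ := lintegral_mono_set (fun y hy => hy.1)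

theorem hz_U0 (B : ℝ≥0∞) (hB : 1 < B) (hB' : B ≠ ∞) (q : ℝ) (hq : 0 < q)
    (p : ℝ≥0∞) (hp0 : 0 < p) (hp : p ≠ ∞) :
    ∃ C : ℝ≥0∞, C ≠ ∞ ∧ ∀ f g : X → ℝ, ∀ τ : ℝ, 0 < τ →
      (∀ s, rearr μ g s ≤ rearr μ f s) → (∀ s, τ ≤ s → rearr μ g s = 0) →
      lorentzNorm μ p p g ^ q ≤ C * ∑' k : ℕ, B ^ k *
        (ENNReal.ofReal (((1/2:ℝ) ^ (k+1) * τ) ^ p.toReal⁻¹) *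
          rearr μ f ((1/2:ℝ) ^ (k+1) * τ)) ^ q := by
  have hP : 0 < p.toReal := ENNReal.toReal_pos hp0.ne' hp
  obtain ⟨C, hC, h⟩ := hz_tsum_pow B hB hB' (q / p.toReal) (by positivity)
  refine ⟨C, hC, fun f g τ hτ h1 h2 => ?_⟩
  set P := p.toReal
  set v : ℕ → ℝ≥0∞ := fun k => ENNReal.ofReal (((1/2:ℝ) ^ (k+1) * τ) ^ P⁻¹) *
          rearr μ f ((1/2:ℝ) ^ (k+1) * τ) with hv
  have key : ∫⁻ t in Set.Ioi (0:ℝ), rearr μ g t ^ P ≤ ∑' k, v k ^ P := by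
    have hcov : Set.Ioi (0:ℝ) ⊆ (⋃ k : ℕ, Set.Ioc ((1/2:ℝ) ^ (k+1) * τ) ((1/2:ℝ) ^ k * τ)) ∪ Set.Ici τ := by
      intro s hs
      have hs : 0 < s := hs
      rcases le_or_gt τ s with h | h
      · exact Or.inr h
      · left
        obtain ⟨n, hn1, hn2⟩ := exists_nat_pow_near_of_lt_one (x := s / τ) (y := (1/2:ℝ))
          (by positivity) (by rw [div_le_one hτ]; exact h.le) (by norm_num) (by norm_num)
        rw [Set.mem_iUnion]
        refine ⟨n, ?_, ?_⟩
        · rwa [lt_div_iff₀ hτ] at hn1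
        · rwa [div_le_iff₀ hτ] at hn2
    calc _ ≤ ∫⁻ t in (⋃ k : ℕ, Set.Ioc ((1/2:ℝ) ^ (k+1) * τ) ((1/2:ℝ) ^ k * τ)) ∪ Set.Ici τ,
            rearr μ g t ^ P := lintegral_mono_set hcov
      _ ≤ (∫⁻ t in (⋃ k : ℕ, Set.Ioc ((1/2:ℝ) ^ (k+1) * τ) ((1/2:ℝ) ^ k * τ)), rearr μ g t ^ P)
          + ∫⁻ t in Set.Ici τ, rearr μ g t ^ P := lintegral_union_le _ _ _
      _ = ∫⁻ t in (⋃ k : ℕ, Set.Ioc ((1/2:ℝ) ^ (k+1) * τ) ((1/2:ℝ) ^ k * τ)), rearr μ g t ^ P := by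
          have : ∫⁻ t in Set.Ici τ, rearr μ g t ^ P = ∫⁻ t in Set.Ici τ, 0 := by
            apply setLIntegral_congr_fun measurableSet_Ici
            intro t ht
            simp only
            rw [h2 t ht, ENNReal.zero_rpow_of_pos hP]
          rw [this]; simp
      _ ≤ ∑' k : ℕ, ∫⁻ t in Set.Ioc ((1/2:ℝ) ^ (k+1) * τ) ((1/2:ℝ) ^ k * τ), rearr μ g t ^ P :=
          lintegral_iUnion_le _ _
      _ ≤ _ := by
          apply ENNReal.tsum_le_tsum
          intro k
          apply hz_piece _ P hP _ (by positivity) _ _ measurableSet_Ioc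
          · rw [Real.volume_Ioc]
            apply ENNReal.ofReal_le_ofReal
            rw [pow_succ]; linarith
          · intro t ht
            exact (h1 t).trans (hz_rearr_anti μ f ht.1.le)
  rw [hz_lor_eq μ p hp0 hp, ← ENNReal.rpow_mul]
  have e : P⁻¹ * q = q / P := by ring
  rw [e]
  refine (ENNReal.rpow_le_rpow key (by positivity)).trans ((h _).trans (le_of_eq ?_))
  congr 2; ext k
  rw [← ENNReal.rpow_mul, mul_div_cancel₀ _ hP.ne']

theorem hz_U1 (B : ℝ≥0∞) (hB : 1 < B) (hB' : B ≠ ∞) (q : ℝ) (hq : 0 < q)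
    (p : ℝ≥0∞) (hp0 : 0 < p) :
    ∃ C : ℝ≥0∞, C ≠ ∞ ∧ ∀ f g : X → ℝ, ∀ τ : ℝ, 0 < τ →
      (∀ s, rearr μ g s ≤ rearr μ f s) → (∀ s, rearr μ g s ≤ rearr μ f τ) →
      lorentzNorm μ p p g ^ q ≤ C * ∑' k : ℕ, B ^ k *
        (ENNReal.ofReal (((2:ℝ) ^ k * τ) ^ p.toReal⁻¹) *
          rearr μ f ((2:ℝ) ^ k * τ)) ^ q := by
  rcases eq_or_ne p ∞ with rfl | hp
  · refine ⟨1, by simp, fun f g τ hτ h1 h2 => ?_⟩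
    rw [one_mul]
    refine le_trans ?_ (ENNReal.le_tsum 0)
    rw [hz_lor_top]
    simp only [ENNReal.toReal_top, _root_.inv_zero, Real.rpow_zero, ENNReal.ofReal_one, one_mul, pow_zero]
    apply ENNReal.rpow_le_rpow _ hq.le
    exact iSup_le fun t => h2 t.1
  have hP : 0 < p.toReal := ENNReal.toReal_pos hp0.ne' hp
  obtain ⟨C, hC, h⟩ := hz_tsum_pow B hB hB' (q / p.toReal) (by positivity)
  refine ⟨2 ^ (q / p.toReal) * C, ENNReal.mul_ne_top
    (ENNReal.rpow_ne_top_of_nonneg (by positivity) (by simp)) hC, fun f g τ hτ h1 h2 => ?_⟩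
  set P := p.toReal
  set v : ℕ → ℝ≥0∞ := fun k => ENNReal.ofReal (((2:ℝ) ^ k * τ) ^ P⁻¹) *
          rearr μ f ((2:ℝ) ^ k * τ) with hv
  have key : ∫⁻ t in Set.Ioi (0:ℝ), rearr μ g t ^ P ≤ 2 * ∑' k, v k ^ P := by
    have hcov : Set.Ioi (0:ℝ) ⊆ (⋃ k : ℕ, Set.Ico ((2:ℝ) ^ k * τ) ((2:ℝ) ^ (k+1) * τ)) ∪ Set.Ioc 0 τ := by
      intro s hs
      have hs : 0 < s := hs
      rcases le_or_gt s τ with h | h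
      · exact Or.inr ⟨hs, h⟩
      · left
        obtain ⟨n, hn1, hn2⟩ := exists_nat_pow_near (x := s / τ) (y := (2:ℝ))
          (by rw [one_le_div hτ]; exact h.le) (by norm_num)
        rw [Set.mem_iUnion]
        refine ⟨n, ?_, ?_⟩
        · rwa [le_div_iff₀ hτ] at hn1
        · rwa [div_lt_iff₀ hτ] at hn2
    calc _ ≤ ∫⁻ t in (⋃ k : ℕ, Set.Ico ((2:ℝ) ^ k * τ) ((2:ℝ) ^ (k+1) * τ)) ∪ Set.Ioc 0 τ,
            rearr μ g t ^ P := lintegral_mono_set hcov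
      _ ≤ (∫⁻ t in (⋃ k : ℕ, Set.Ico ((2:ℝ) ^ k * τ) ((2:ℝ) ^ (k+1) * τ)), rearr μ g t ^ P)
          + ∫⁻ t in Set.Ioc 0 τ, rearr μ g t ^ P := lintegral_union_le _ _ _
      _ ≤ ∑' k, v k ^ P + v 0 ^ P := by
          apply add_le_add
          · refine (lintegral_iUnion_le _ _).trans ?_
            apply ENNReal.tsum_le_tsum
            intro k
            apply hz_piece _ P hP _ (by positivity) _ _ measurableSet_Ico
            · rw [Real.volume_Ico]
              apply ENNReal.ofReal_le_ofReal
              rw [pow_succ]; linarith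
            · intro t ht
              exact (h1 t).trans (hz_rearr_anti μ f ht.1)
          · apply hz_piece _ P hP _ (by positivity) _ _ measurableSet_Ioc
            · rw [Real.volume_Ioc]
              apply ENNReal.ofReal_le_ofReal
              simp
            · intro t ht
              simpa using h2 t
      _ ≤ ∑' k, v k ^ P + ∑' k, v k ^ P := by
          gcongr
          exact ENNReal.le_tsum (f := fun k => v k ^ P) 0
      _ = _ := by rw [two_mul]
  rw [hz_lor_eq μ p hp0 hp, ← ENNReal.rpow_mul]
  have e : P⁻¹ * q = q / P := by ring
  rw [e]
  refine (ENNReal.rpow_le_rpow key (by positivity)).trans ?_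
  rw [ENNReal.mul_rpow_of_nonneg _ _ (by positivity), mul_assoc]
  gcongr
  refine (h _).trans (le_of_eq ?_)
  congr 2; ext k
  rw [← ENNReal.rpow_mul, mul_div_cancel₀ _ hP.ne']

end lorentz

theorem hz_scalar (τ κ q e s : ℝ) (hτ : 0 < τ) (hκ : 0 < κ) (hq : 0 < q) (R : ℝ≥0∞) :
    ENNReal.ofReal (τ ^ (-e - 1)) * (ENNReal.ofReal ((κ * τ) ^ (s + e / q)) * R) ^ q =
      ENNReal.ofReal (κ ^ e) * ((ENNReal.ofReal ((κ * τ) ^ s) * R) ^ q / ENNReal.ofReal τ) := by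
  have hk : 0 < κ * τ := by positivity
  rw [ENNReal.mul_rpow_of_nonneg _ _ hq.le, ENNReal.mul_rpow_of_nonneg _ _ hq.le,
    ENNReal.ofReal_rpow_of_pos (by positivity), ENNReal.ofReal_rpow_of_pos (by positivity),
    div_eq_mul_inv _ (ENNReal.ofReal τ), ← ENNReal.ofReal_inv_of_pos hτ, ← Real.rpow_mul hk.le, ← Real.rpow_mul hk.le]
  have : τ ^ (-e - 1) * (κ * τ) ^ ((s + e / q) * q) = κ ^ e * (κ * τ) ^ (s * q) * τ⁻¹ := by
    have e1 : (s + e / q) * q = s * q + e := by field_simp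
    rw [e1, Real.rpow_add hk, Real.mul_rpow hκ.le hτ.le (z := e), Real.rpow_sub_one hτ.ne',
      Real.rpow_neg hτ.le]
    field_simp
  have h2 : ENNReal.ofReal (τ ^ (-e - 1)) * ENNReal.ofReal ((κ * τ) ^ ((s + e / q) * q)) =
      ENNReal.ofReal (κ ^ e) * ENNReal.ofReal ((κ * τ) ^ (s * q)) * ENNReal.ofReal τ⁻¹ := by
    rw [← ENNReal.ofReal_mul (by positivity), this, ENNReal.ofReal_mul (by positivity),
      ENNReal.ofReal_mul (by positivity)]
  rw [← mul_assoc, h2]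
  ring

theorem hz_geo_aux (e : ℝ) (he : 0 < e) (m : ℕ → ℝ)
    (hm : ∀ k, m k ≤ (2:ℝ) ^ (-(k * e))) :
    ∑' k : ℕ, ENNReal.ofReal ((2:ℝ) ^ (e / 2)) ^ k * ENNReal.ofReal (m k) ≠ ∞ := by
  have h : ∀ k : ℕ, ENNReal.ofReal ((2:ℝ) ^ (e / 2)) ^ k * ENNReal.ofReal (m k) ≤
      ENNReal.ofReal ((2:ℝ) ^ (-(e / 2))) ^ k := by
    intro k
    rw [← ENNReal.ofReal_pow (by positivity), ← ENNReal.ofReal_pow (by positivity),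
      ← ENNReal.ofReal_mul (by positivity)]
    apply ENNReal.ofReal_le_ofReal
    calc ((2:ℝ) ^ (e / 2)) ^ k * m k ≤ ((2:ℝ) ^ (e / 2)) ^ k * (2:ℝ) ^ (-(k * e)) := by
          gcongr; exact hm k
      _ = _ := by
          rw [← Real.rpow_natCast, ← Real.rpow_natCast, ← Real.rpow_mul (by norm_num),
            ← Real.rpow_mul (by norm_num), ← Real.rpow_add (by norm_num)]
          congr 1; ring
  apply ne_top_of_le_ne_top _ (ENNReal.tsum_le_tsum h)
  rw [ENNReal.tsum_geometric, ENNReal.inv_ne_top]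
  apply (tsub_pos_of_lt _).ne'
  rw [← ENNReal.ofReal_one, ENNReal.ofReal_lt_ofReal_iff (by norm_num)]
  exact Real.rpow_lt_one_of_one_lt_of_neg (by norm_num) (by linarith)

theorem hz_geo0 (e : ℝ) (he : 0 < e) :
    ∑' k : ℕ, ENNReal.ofReal ((2:ℝ) ^ (e / 2)) ^ k *
      ENNReal.ofReal (((1/2:ℝ) ^ (k + 1)) ^ e) ≠ ∞ := by
  apply hz_geo_aux e he
  intro k
  have : ((1/2:ℝ) ^ (k + 1)) = (2:ℝ) ^ (-((k:ℝ) + 1)) := by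
    rw [Real.rpow_neg (by norm_num)]
    norm_cast
    simp
  rw [this, ← Real.rpow_mul (by norm_num)]
  apply Real.rpow_le_rpow_of_exponent_le (by norm_num)
  nlinarith

theorem hz_geo1 (e : ℝ) (he : 0 < e) :
    ∑' k : ℕ, ENNReal.ofReal ((2:ℝ) ^ (e / 2)) ^ k *
      ENNReal.ofReal (((2:ℝ) ^ k) ^ (-e)) ≠ ∞ := by
  apply hz_geo_aux e he
  intro k
  rw [← Real.rpow_natCast, ← Real.rpow_mul (by norm_num)]
  apply le_of_eq; congr 1; ring

theorem hz_int_sum (G : ℝ → ℝ≥0∞) (hG : Measurable G) (κ : ℕ → ℝ) (hκ : ∀ k, 0 < κ k)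
    (m : ℕ → ℝ≥0∞) :
    ∫⁻ τ in Set.Ioi (0:ℝ), ∑' k, m k * (G (κ k * τ) / ENNReal.ofReal τ) =
      (∑' k, m k) * ∫⁻ τ in Set.Ioi (0:ℝ), G τ / ENNReal.ofReal τ := by
  have hmeas : ∀ k, Measurable fun τ : ℝ => G (κ k * τ) / ENNReal.ofReal τ := fun k =>
    (hG.comp (measurable_const_mul (κ k))).div ENNReal.measurable_ofReal
  rw [lintegral_tsum]
  · rw [← ENNReal.tsum_mul_right]
    congr 1; ext k
    rw [lintegral_const_mul _ (hmeas k), hz_scale (κ k) (hκ k)]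
  · intro k
    exact ((hmeas k).const_mul _).aemeasurable

section block
variable {X : Type*} [MeasurableSpace X] (μ : Measure X)

noncomputable def hzX0 (p : ℝ≥0∞) (A : Set X) (g : {g : X → ℝ // Measurable g}) : ℝ≥0∞ :=
  lorentzNorm μ p p (A.indicator g.1)

noncomputable def hzX1 (p : ℝ≥0∞) (A : Set X) (f : X → ℝ) (g : {g : X → ℝ // Measurable g}) : ℝ≥0∞ :=
  lorentzNorm μ p p (A.indicator (f - g.1))

theorem hz_block_pt (p₀ p₁ : ℝ≥0∞) (hp₀ : 0 < p₀) (hp₀' : p₀ ≠ ∞) (hp₁ : 0 < p₁)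
    (q c : ℝ) (hq : 0 < q) (B₀ B₁ : ℝ≥0∞) (hB₀ : 1 < B₀) (hB₀' : B₀ ≠ ∞)
    (hB₁ : 1 < B₁) (hB₁' : B₁ ≠ ∞) :
    ∃ C₀ C₁ : ℝ≥0∞, C₀ ≠ ∞ ∧ C₁ ≠ ∞ ∧ ∀ (A : Set X) (f : X → ℝ), MeasurableSet A → Measurable f →
      ∀ τ : ℝ, 0 < τ → hzM (hzX0 μ p₀ A) (hzX1 μ p₁ A f) q q c τ ≤
        C₀ * ∑' k : ℕ, B₀ ^ k * (ENNReal.ofReal (((1/2:ℝ) ^ (k+1) * τ) ^ p₀.toReal⁻¹) *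
          rearr μ (A.indicator f) ((1/2:ℝ) ^ (k+1) * τ)) ^ q +
        ENNReal.ofReal (τ ^ c) * (C₁ * ∑' k : ℕ, B₁ ^ k *
          (ENNReal.ofReal (((2:ℝ) ^ k * τ) ^ p₁.toReal⁻¹) *
            rearr μ (A.indicator f) ((2:ℝ) ^ k * τ)) ^ q) := by
  obtain ⟨C₀, hC₀, h₀⟩ := hz_U0 μ B₀ hB₀ hB₀' q hq p₀ hp₀ hp₀'
  obtain ⟨C₁, hC₁, h₁⟩ := hz_U1 μ B₁ hB₁ hB₁' q hq p₁ hp₁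
  refine ⟨C₀ + 1, C₁, by simp [hC₀], hC₁, fun A f hA hf τ hτ => ?_⟩
  set F := A.indicator f with hF
  rcases eq_or_ne (rearr μ F τ) ∞ with htop | hfin
  · refine le_trans le_top (le_trans ?_ le_self_add)
    refine le_trans ?_ (mul_le_mul_right (ENNReal.le_tsum 0) _)
    have h1 : rearr μ F ((1/2:ℝ) ^ (0+1) * τ) = ∞ := by
      apply top_le_iff.1
      rw [← htop]
      apply hz_rearr_anti
      linarith
    have h2 : 0 < ((1/2:ℝ) ^ (0+1) * τ) ^ p₀.toReal⁻¹ := by positivity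
    rw [h1, ENNReal.mul_top (by simpa using h2), ENNReal.top_rpow_of_pos hq, pow_zero, one_mul,
      ENNReal.mul_top (by simp)]
  · set l := (rearr μ F τ).toReal with hl
    have hl0 : 0 ≤ l := ENNReal.toReal_nonneg
    have hFm : Measurable F := hf.indicator hA
    have hgm : Measurable (fun x => F x - hzClamp l (F x)) := by
      unfold hzClamp
      fun_prop
    have e0 : A.indicator (fun x => F x - hzClamp l (F x)) = fun x => F x - hzClamp l (F x) := by
      ext x
      by_cases hx : x ∈ A
      · simp [hx]
      · simp [hx, hF, hzClamp_zero l hl0]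
    have e1 : A.indicator (f - fun x => F x - hzClamp l (F x)) = fun x => hzClamp l (F x) := by
      ext x
      by_cases hx : x ∈ A
      · simp [hx, hF]
      · simp [hx, hF, hzClamp_zero l hl0]
    refine (iInf_le _ ⟨_, hgm⟩).trans ?_
    refine (max_le_add_of_nonneg zero_le zero_le).trans ?_
    unfold hzX0 hzX1
    simp only
    rw [e0, e1]
    apply add_le_add
    · refine (h₀ F _ τ hτ ?_ ?_).trans (by gcongr; exact le_self_add)
      · exact fun s => hz_rearr_mono μ _ _ (fun x => (hzClamp_abs l (F x) hl0).2.2.1) s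
      · exact fun s hs => hz_trunc_g μ F τ hfin s hs
    · gcongr
      refine (h₁ F _ τ hτ ?_ ?_)
      · exact fun s => hz_rearr_mono μ _ _ (fun x => (hzClamp_abs l (F x) hl0).1) s
      · exact fun s => hz_trunc_h μ F τ hfin s

theorem hz_G_meas (F : X → ℝ) (s q : ℝ) :
    Measurable (fun τ : ℝ => (ENNReal.ofReal (τ ^ s) * rearr μ F τ) ^ q) := by
  have := (hz_rearr_anti μ F).measurable
  exact (Measurable.mul (by fun_prop) this).pow_const q

theorem hz_block_upper (p₀ p₁ : ℝ≥0∞) (hp₀ : 0 < p₀) (hp₀' : p₀ ≠ ∞) (hp₁ : 0 < p₁)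
    (q θ s δ : ℝ) (hq : 0 < q) (hθ0 : 0 < θ) (hθ1 : θ < 1) (hδ : 0 < δ)
    (hδe : δ = p₀.toReal⁻¹ - p₁.toReal⁻¹)
    (hs : s = (1 - θ) * p₀.toReal⁻¹ + θ * p₁.toReal⁻¹) :
    ∃ C : ℝ≥0∞, C ≠ ∞ ∧ ∀ (A : Set X) (f : X → ℝ), MeasurableSet A → Measurable f →
      ∫⁻ τ in Set.Ioi (0:ℝ), ENNReal.ofReal (τ ^ (-(θ * q * δ) - 1)) *
        hzM (hzX0 μ p₀ A) (hzX1 μ p₁ A f) q q (q * δ) τ ≤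
      C * ∫⁻ τ in Set.Ioi (0:ℝ), (ENNReal.ofReal (τ ^ s) * rearr μ (A.indicator f) τ) ^ q
        / ENNReal.ofReal τ := by
  set e₀ := θ * q * δ with he₀
  set e₁ := (1 - θ) * q * δ with he₁
  have he₀p : 0 < e₀ := by positivity
  have he₁p : 0 < e₁ := by have : 0 < 1 - θ := by linarith
                           positivity
  have hB : ∀ e : ℝ, 0 < e → 1 < ENNReal.ofReal ((2:ℝ) ^ (e / 2)) := by
    intro e he
    rw [← ENNReal.ofReal_one, ENNReal.ofReal_lt_ofReal_iff (by positivity)]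
    exact Real.one_lt_rpow (by norm_num) (by positivity)
  obtain ⟨C₀, C₁, hC₀, hC₁, h⟩ := hz_block_pt μ p₀ p₁ hp₀ hp₀' hp₁ q (q * δ) hq
    _ _ (hB e₀ he₀p) (by simp) (hB e₁ he₁p) (by simp)
  refine ⟨C₀ * (∑' k : ℕ, ENNReal.ofReal ((2:ℝ) ^ (e₀ / 2)) ^ k *
      ENNReal.ofReal (((1/2:ℝ) ^ (k + 1)) ^ e₀)) + C₁ * ∑' k : ℕ, ENNReal.ofReal ((2:ℝ) ^ (e₁ / 2)) ^ k *
      ENNReal.ofReal (((2:ℝ) ^ k) ^ (-e₁)), ?_, ?_⟩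
  · exact ENNReal.add_ne_top.2 ⟨ENNReal.mul_ne_top hC₀ (hz_geo0 e₀ he₀p),
      ENNReal.mul_ne_top hC₁ (hz_geo1 e₁ he₁p)⟩
  intro A f hA hf
  set F := A.indicator f
  have hG := hz_G_meas μ F s q
  set G : ℝ → ℝ≥0∞ := fun τ => (ENNReal.ofReal (τ ^ s) * rearr μ F τ) ^ q with hGdef
  rw [add_mul, mul_assoc, mul_assoc, ← hz_int_sum G hG (fun k => (1/2:ℝ) ^ (k + 1)) (fun k => by positivity),
    ← hz_int_sum G hG (fun k => (2:ℝ) ^ k) (fun k => by positivity)]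
  rw [← lintegral_const_mul' _ _ hC₀, ← lintegral_const_mul' _ _ hC₁, ← lintegral_add_left]
  swap
  · refine Measurable.const_mul (Measurable.ennreal_tsum fun k => Measurable.const_mul ?_ _) _
    exact (hG.comp (measurable_const_mul _)).div ENNReal.measurable_ofReal
  apply setLIntegral_mono' measurableSet_Ioi
  intro τ hτ
  have hτ : 0 < τ := hτ
  refine (mul_le_mul_right (h A f hA hf τ hτ) _).trans ?_
  rw [mul_add]
  apply add_le_add
  · rw [mul_left_comm]
    gcongr
    rw [← ENNReal.tsum_mul_left]
    apply ENNReal.tsum_le_tsum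
    intro k
    have hk : p₀.toReal⁻¹ = s + e₀ / q := by
      rw [he₀, hs, hδe]; field_simp; ring
    rw [hk, mul_left_comm, hz_scalar τ _ q e₀ s hτ (by positivity) hq, mul_assoc]
  · rw [← mul_assoc, ← ENNReal.ofReal_mul (by positivity), ← Real.rpow_add hτ]
    have : -e₀ - 1 + q * δ = -(-e₁) - 1 := by rw [he₀, he₁]; ring
    rw [this, mul_left_comm]
    gcongr
    rw [← ENNReal.tsum_mul_left]
    apply ENNReal.tsum_le_tsum
    intro k
    have hk : p₁.toReal⁻¹ = s + (-e₁) / q := by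
      rw [he₁, hs, hδe]; field_simp; ring
    rw [hk, mul_left_comm, hz_scalar τ _ q (-e₁) s hτ (by positivity) hq, mul_assoc]

theorem hz_block_lower (p₀ p₁ : ℝ≥0∞) (hp₀ : 0 < p₀) (hp₁ : 0 < p₁)
    (q θ s δ : ℝ) (hq : 0 < q)
    (hδe : δ = p₀.toReal⁻¹ - p₁.toReal⁻¹)
    (hs : s = (1 - θ) * p₀.toReal⁻¹ + θ * p₁.toReal⁻¹) :
    ∃ C : ℝ≥0∞, C ≠ ∞ ∧ ∀ (A : Set X) (f : X → ℝ),
      ∫⁻ τ in Set.Ioi (0:ℝ), (ENNReal.ofReal (τ ^ s) * rearr μ (A.indicator f) τ) ^ q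
        / ENNReal.ofReal τ ≤
      C * ∫⁻ τ in Set.Ioi (0:ℝ), ENNReal.ofReal (τ ^ (-(θ * q * δ) - 1)) *
        hzM (hzX0 μ p₀ A) (hzX1 μ p₁ A f) q q (q * δ) τ := by
  set e₀ := θ * q * δ with he₀
  set D : ℝ≥0∞ := ENNReal.ofReal ((2:ℝ) ^ p₀.toReal⁻¹ * 2) with hD
  set E : ℝ≥0∞ := ENNReal.ofReal ((2:ℝ) ^ (-e₀)) with hE
  refine ⟨E * D ^ q, ENNReal.mul_ne_top (by simp [hE]) (ENNReal.rpow_ne_top_of_nonneg hq.le (by simp [hD])),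
    fun A f => ?_⟩
  set F := A.indicator f with hF
  rw [← hz_scale 2 (by norm_num) (fun τ => (ENNReal.ofReal (τ ^ s) * rearr μ F τ) ^ q),
    ← lintegral_const_mul' _ _ (ENNReal.mul_ne_top (by simp [hE]) (ENNReal.rpow_ne_top_of_nonneg hq.le (by simp [hD])))]
  apply setLIntegral_mono' measurableSet_Ioi
  intro τ hτ
  have hτ : 0 < τ := hτ
  have key : (ENNReal.ofReal ((2 * τ) ^ p₀.toReal⁻¹) * rearr μ F (2 * τ)) ^ q ≤
      D ^ q * hzM (hzX0 μ p₀ A) (hzX1 μ p₁ A f) q q (q * δ) τ := by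
    unfold hzM
    rw [ENNReal.mul_iInf_of_ne]
    rotate_left
    · apply (ENNReal.rpow_pos _ (by simp [hD])).ne'
      rw [hD]; simp; positivity
    · exact ENNReal.rpow_ne_top_of_nonneg hq.le (by simp [hD])
    refine le_iInf fun g => ?_
    have hmax : max (hzX0 μ p₀ A g ^ q) (ENNReal.ofReal (τ ^ (q * δ)) * hzX1 μ p₁ A f g ^ q) =
        (max (hzX0 μ p₀ A g) (ENNReal.ofReal (τ ^ δ) * hzX1 μ p₁ A f g)) ^ q := by
      rw [(ENNReal.monotone_rpow_of_nonneg hq.le).map_max, ENNReal.mul_rpow_of_nonneg _ _ hq.le,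
        ENNReal.ofReal_rpow_of_pos (by positivity), ← Real.rpow_mul hτ.le, mul_comm δ q]
    rw [hmax, ← ENNReal.mul_rpow_of_nonneg _ _ hq.le]
    apply ENNReal.rpow_le_rpow _ hq.le
    have h1 : rearr μ F (2 * τ) ≤ rearr μ (A.indicator g.1) τ + rearr μ (A.indicator (f - g.1)) τ := by
      apply hz_rearr_add _ _ _ _ _ _ hτ.le
      intro x
      by_cases hx : x ∈ A
      · simp only [hF, hx, Set.indicator_of_mem, Pi.sub_apply]
        calc |f x| = |g.1 x + (f x - g.1 x)| := by ring_nf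
          _ ≤ _ := abs_add_le _ _
      · simp [hF, hx]
    have h2 : ENNReal.ofReal (τ ^ p₀.toReal⁻¹) * rearr μ (A.indicator g.1) τ ≤ hzX0 μ p₀ A g :=
      hz_lor_lower μ p₀ hp₀ _ τ hτ
    have h3 : ENNReal.ofReal (τ ^ p₁.toReal⁻¹) * rearr μ (A.indicator (f - g.1)) τ ≤ hzX1 μ p₁ A f g :=
      hz_lor_lower μ p₁ hp₁ _ τ hτ
    have h4 : ENNReal.ofReal (τ ^ p₀.toReal⁻¹) = ENNReal.ofReal (τ ^ δ) * ENNReal.ofReal (τ ^ p₁.toReal⁻¹) := by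
      rw [← ENNReal.ofReal_mul (by positivity), ← Real.rpow_add hτ, hδe, sub_add_cancel]
    set m := max (hzX0 μ p₀ A g) (ENNReal.ofReal (τ ^ δ) * hzX1 μ p₁ A f g)
    calc _ = ENNReal.ofReal ((2:ℝ) ^ p₀.toReal⁻¹) * (ENNReal.ofReal (τ ^ p₀.toReal⁻¹) * rearr μ F (2 * τ)) := by
          rw [Real.mul_rpow (by norm_num) hτ.le, ENNReal.ofReal_mul (by positivity), mul_assoc]
      _ ≤ ENNReal.ofReal ((2:ℝ) ^ p₀.toReal⁻¹) * (m + m) := by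
          gcongr
          calc _ ≤ ENNReal.ofReal (τ ^ p₀.toReal⁻¹) * (rearr μ (A.indicator g.1) τ + rearr μ (A.indicator (f - g.1)) τ) := by
                gcongr
            _ ≤ _ := by
                rw [mul_add]
                apply add_le_add
                · exact h2.trans (le_max_left _ _)
                · refine le_trans ?_ (le_max_right _ _)
                  rw [h4, mul_assoc]
                  gcongr
      _ = D * m := by
          rw [← two_mul, hD, ENNReal.ofReal_mul (by positivity), mul_assoc]; simp
  have hk : p₀.toReal⁻¹ = s + e₀ / q := by
    rw [he₀, hs, hδe]; field_simp; ring
  have hsc := hz_scalar τ 2 q e₀ s hτ (by norm_num) hq (rearr μ F (2 * τ))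
  rw [← hk] at hsc
  have hE2 : E * ENNReal.ofReal ((2:ℝ) ^ e₀) = 1 := by
    rw [hE, ← ENNReal.ofReal_mul (by positivity), ← Real.rpow_add (by norm_num)]; simp
  calc _ = E * (ENNReal.ofReal ((2:ℝ) ^ e₀) * ((ENNReal.ofReal ((2 * τ) ^ s) * rearr μ F (2 * τ)) ^ q / ENNReal.ofReal τ)) := by
        rw [← mul_assoc, hE2, one_mul]
    _ ≤ E * (ENNReal.ofReal (τ ^ (-e₀ - 1)) * (D ^ q * hzM (hzX0 μ p₀ A) (hzX1 μ p₁ A f) q q (q * δ) τ)) := by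
        rw [← hsc]
        gcongr
    _ = _ := by ring

end block

theorem hz_dec_le {ι U : Type*} [Nonempty ι] (x0 x1 : ι → ℝ≥0∞) (y0 y1 : U → ι → ℝ≥0∞)
    (a b : ℝ) (h0 : ∀ i, x0 i ^ a = ∑' u, y0 u i ^ a) (h1 : ∀ i, x1 i ^ b = ∑' u, y1 u i ^ b)
    (c t : ℝ) :
    ∑' u, hzM (y0 u) (y1 u) a b c t ≤ 2 * hzM x0 x1 a b c t := by
  rw [hzM, ENNReal.mul_iInf_of_ne (by simp) (by simp)]
  refine le_iInf fun i => ?_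
  calc ∑' u, hzM (y0 u) (y1 u) a b c t
      ≤ ∑' u, (y0 u i ^ a + ENNReal.ofReal (t ^ c) * y1 u i ^ b) :=
        ENNReal.tsum_le_tsum fun u => (iInf_le _ i).trans (max_le le_self_add le_add_self)
    _ = x0 i ^ a + ENNReal.ofReal (t ^ c) * x1 i ^ b := by
        rw [ENNReal.tsum_add, ENNReal.tsum_mul_left, h0, h1]
    _ ≤ _ := by
        rw [two_mul]
        exact add_le_add (le_max_left _ _) (le_max_right _ _)

theorem hz_dec_ge {ι U : Type*} [Countable U] (x0 x1 : ι → ℝ≥0∞) (y0 y1 : U → ι → ℝ≥0∞)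
    (a b : ℝ) (h0 : ∀ i, x0 i ^ a = ∑' u, y0 u i ^ a) (h1 : ∀ i, x1 i ^ b = ∑' u, y1 u i ^ b)
    (hglue : ∀ k : U → ι, ∃ i, ∀ u, y0 u i = y0 u (k u) ∧ y1 u i = y1 u (k u))
    (c t : ℝ) :
    hzM x0 x1 a b c t ≤ 2 * ∑' u, hzM (y0 u) (y1 u) a b c t := by
  by_cases hfin : ∑' u, hzM (y0 u) (y1 u) a b c t = ∞
  · rw [hfin]; simp
  refine ENNReal.le_of_forall_pos_le_add fun ε hε _ => ?_
  obtain ⟨e, he, hes⟩ := ENNReal.exists_pos_sum_of_countable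
    (ε := (ε : ℝ≥0∞) / 2) (by simpa using hε.ne') U
  have hk : ∀ u, ∃ i, max (y0 u i ^ a) (ENNReal.ofReal (t ^ c) * y1 u i ^ b)
      < hzM (y0 u) (y1 u) a b c t + e u := by
    intro u
    have hu : hzM (y0 u) (y1 u) a b c t ≠ ∞ := ENNReal.ne_top_of_tsum_ne_top hfin u
    exact iInf_lt_iff.1 (ENNReal.lt_add_right hu (by simpa using (he u).ne'))
  choose k hk using hk
  obtain ⟨i, hi⟩ := hglue k
  calc hzM x0 x1 a b c t ≤ max (x0 i ^ a) (ENNReal.ofReal (t ^ c) * x1 i ^ b) := iInf_le _ i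
    _ ≤ x0 i ^ a + ENNReal.ofReal (t ^ c) * x1 i ^ b := max_le le_self_add le_add_self
    _ = ∑' u, (y0 u i ^ a + ENNReal.ofReal (t ^ c) * y1 u i ^ b) := by
        rw [ENNReal.tsum_add, ENNReal.tsum_mul_left, h0, h1]
    _ ≤ ∑' u, 2 * (hzM (y0 u) (y1 u) a b c t + e u) := by
        refine ENNReal.tsum_le_tsum fun u => ?_
        rw [(hi u).1, (hi u).2, two_mul]
        exact add_le_add ((le_max_left _ _).trans (hk u).le) ((le_max_right _ _).trans (hk u).le)
    _ = 2 * ∑' u, hzM (y0 u) (y1 u) a b c t + 2 * ∑' u, (e u : ℝ≥0∞) := by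
        rw [ENNReal.tsum_mul_left, ENNReal.tsum_add, mul_add]
    _ ≤ 2 * ∑' u, hzM (y0 u) (y1 u) a b c t + 2 * ((ε : ℝ≥0∞) / 2) := by gcongr
    _ = _ := by rw [ENNReal.mul_div_cancel (by simp) (by simp)]

theorem hzM_aem {ι : Type*} (x0 x1 : ι → ℝ≥0∞) (a b c g : ℝ) (hc : 0 ≤ c) :
    AEMeasurable (fun t => ENNReal.ofReal (t ^ (-g - 1)) * hzM x0 x1 a b c t)
      (volume.restrict (Ioi (0 : ℝ))) := by
  refine AEMeasurable.mul (by fun_prop) ?_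
  exact aemeasurable_restrict_of_monotoneOn measurableSet_Ioi (hzM_mono x0 x1 a b c hc)

theorem hz_decJ {ι U : Type*} [Nonempty ι] [Countable U] (x0 x1 : ι → ℝ≥0∞)
    (y0 y1 : U → ι → ℝ≥0∞)
    (a b : ℝ) (ha : 0 < a) (hb : 0 < b)
    (h0 : ∀ i, x0 i ^ a = ∑' u, y0 u i ^ a) (h1 : ∀ i, x1 i ^ b = ∑' u, y1 u i ^ b)
    (hglue : ∀ k : U → ι, ∃ i, ∀ u, y0 u i = y0 u (k u) ∧ y1 u i = y1 u (k u))
    (g A B : ℝ) (hg : 0 < g) (hA : A = a * (1 - g)) (hB : B = b * g) :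
    ∑' u, hzJ (y0 u) (y1 u) A B ≤ 2 * hzJ x0 x1 A B ∧
    hzJ x0 x1 A B ≤ 2 * ∑' u, hzJ (y0 u) (y1 u) A B := by
  have hA' : A = a * (1 - g / 1) := by rw [hA, div_one]
  have hB' : B = b * g / 1 := by rw [hB, div_one]
  have hk0 : ENNReal.ofReal (a / g) ≠ 0 := by simp; positivity
  have hkt : ENNReal.ofReal (a / g) ≠ ∞ := by simp
  have hx := hz_power x0 x1 a b 1 g ha hb one_pos hg
  have hy := fun u => hz_power (y0 u) (y1 u) a b 1 g ha hb one_pos hg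
  rw [← hA', ← hB'] at hx
  simp only [← hA', ← hB'] at hy
  have hsum : ∫⁻ t in Ioi (0 : ℝ), ENNReal.ofReal (t ^ (-g - 1)) *
      ∑' u, hzM (y0 u) (y1 u) a b 1 t = ENNReal.ofReal (a / g) * ∑' u, hzJ (y0 u) (y1 u) A B := by
    rw [← ENNReal.tsum_mul_left]
    simp only [← hy, ← ENNReal.tsum_mul_left]
    exact lintegral_tsum fun u => hzM_aem _ _ _ _ _ _ zero_le_one
  constructor
  · rw [← ENNReal.mul_le_mul_iff_right hk0 hkt, ← hsum, mul_left_comm, ← hx,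
      ← lintegral_const_mul' _ _ (by simp)]
    refine lintegral_mono fun t => ?_
    rw [mul_left_comm]
    gcongr
    exact hz_dec_le x0 x1 y0 y1 a b h0 h1 1 t
  · rw [← ENNReal.mul_le_mul_iff_right hk0 hkt, mul_left_comm, ← hsum, ← hx,
      ← lintegral_const_mul' _ _ (by simp)]
    refine lintegral_mono fun t => ?_
    rw [mul_left_comm]
    gcongr
    exact hz_dec_ge x0 x1 y0 y1 a b h0 h1 hglue 1 t

theorem hz_weight (R : ℝ≥0∞) (t θ Q : ℝ) (ht : 0 < t) (hQ : 0 < Q) :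
    (ENNReal.ofReal (t ^ (-θ)) * R) ^ Q / ENNReal.ofReal t
      = ENNReal.ofReal (t ^ (-(θ * Q) - 1)) * R ^ Q := by
  rw [ENNReal.mul_rpow_of_nonneg _ _ hQ.le, ENNReal.ofReal_rpow_of_pos (by positivity),
    ← Real.rpow_mul ht.le, div_eq_mul_inv _ (ENNReal.ofReal t), ← ENNReal.ofReal_inv_of_pos ht,
    mul_right_comm, ← ENNReal.ofReal_mul (by positivity), ← Real.rpow_neg_one t,
    ← Real.rpow_add ht]
  congr 3
  ring_nf

theorem hz_Kfun {Y : Type*} [MeasurableSpace Y] (n0 n1 : (Y → ℝ) → ℝ≥0∞) (f : Y → ℝ)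
    (hf : Measurable f) (Q t : ℝ) (hQ : 0 < Q) (ht : 0 < t) :
    hzM (fun g : {g : Y → ℝ // Measurable g} => n0 g.1)
      (fun g : {g : Y → ℝ // Measurable g} => n1 (f - g.1)) Q Q Q t ≤ Kfun n0 n1 t f ^ Q ∧
    Kfun n0 n1 t f ^ Q ≤ 2 ^ Q * hzM (fun g : {g : Y → ℝ // Measurable g} => n0 g.1)
      (fun g : {g : Y → ℝ // Measurable g} => n1 (f - g.1)) Q Q Q t := by
  have hM : hzM (fun g : {g : Y → ℝ // Measurable g} => n0 g.1)
      (fun g : {g : Y → ℝ // Measurable g} => n1 (f - g.1)) Q Q Q t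
      = (⨅ g : {g : Y → ℝ // Measurable g}, max (n0 g.1) (ENNReal.ofReal t * n1 (f - g.1))) ^ Q := by
    have := (ENNReal.orderIsoRpow Q hQ).map_iInf
      (fun g : {g : Y → ℝ // Measurable g} => max (n0 g.1) (ENNReal.ofReal t * n1 (f - g.1)))
    simp only [ENNReal.orderIsoRpow_apply] at this
    rw [this, hzM]
    refine iInf_congr fun g => ?_
    rw [(ENNReal.monotone_rpow_of_nonneg hQ.le).map_max, ENNReal.mul_rpow_of_nonneg _ _ hQ.le,
      ENNReal.ofReal_rpow_of_pos ht]
  haveI : Nonempty {g : Y → ℝ // Measurable g} := ⟨⟨0, measurable_zero⟩⟩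
  rw [hM]
  constructor
  · refine ENNReal.rpow_le_rpow ?_ hQ.le
    refine le_iInf fun g => le_iInf fun hg => le_iInf fun _ => ?_
    exact (iInf_le _ (⟨g, hg⟩ : {g : Y → ℝ // Measurable g})).trans
      (max_le le_self_add le_add_self)
  · rw [← ENNReal.mul_rpow_of_nonneg _ _ hQ.le]
    refine ENNReal.rpow_le_rpow ?_ hQ.le
    rw [ENNReal.mul_iInf_of_ne (by simp) (by simp)]
    refine le_iInf fun g => ?_
    refine (iInf_le _ g.1).trans ((iInf_le _ g.2).trans ((iInf_le _ (hf.sub g.2)).trans ?_))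
    rw [two_mul]
    exact add_le_add (le_max_left _ _) (le_max_right _ _)

theorem hz_interp {Y : Type*} [MeasurableSpace Y] (n0 n1 : (Y → ℝ) → ℝ≥0∞) (f : Y → ℝ)
    (hf : Measurable f) (θ : ℝ) (hθ : 0 < θ) (q : ℝ≥0∞) (hq0 : 0 < q.toReal) (hq : q ≠ ∞) :
    ENNReal.ofReal (1 / θ) * hzJ (fun g : {g : Y → ℝ // Measurable g} => n0 g.1)
      (fun g : {g : Y → ℝ // Measurable g} => n1 (f - g.1))
        (q.toReal * (1 - θ)) (q.toReal * θ) ≤ interpNorm n0 n1 θ q f ^ q.toReal ∧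
    interpNorm n0 n1 θ q f ^ q.toReal ≤ 2 ^ q.toReal * (ENNReal.ofReal (1 / θ) *
      hzJ (fun g : {g : Y → ℝ // Measurable g} => n0 g.1)
      (fun g : {g : Y → ℝ // Measurable g} => n1 (f - g.1))
        (q.toReal * (1 - θ)) (q.toReal * θ)) := by
  set Q := q.toReal with hQ
  have hI : interpNorm n0 n1 θ q f ^ Q = ∫⁻ t in Ioi (0 : ℝ),
      ENNReal.ofReal (t ^ (-(θ * Q) - 1)) * Kfun n0 n1 t f ^ Q := by
    rw [interpNorm, if_neg hq, ← hQ, ENNReal.rpow_inv_rpow hq0.ne']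
    exact setLIntegral_congr_fun measurableSet_Ioi fun t ht => hz_weight _ t θ Q ht hq0
  have hp := hz_power (fun g : {g : Y → ℝ // Measurable g} => n0 g.1)
      (fun g : {g : Y → ℝ // Measurable g} => n1 (f - g.1)) Q Q Q (θ * Q) hq0 hq0 hq0
      (by positivity)
  have e1 : Q / (θ * Q) = 1 / θ := by field_simp
  have e2 : Q * (1 - θ * Q / Q) = Q * (1 - θ) := by field_simp
  have e3 : Q * (θ * Q) / Q = Q * θ := by field_simp
  rw [e1, e2, e3] at hp
  rw [hI, ← hp]
  constructor
  · refine setLIntegral_mono' measurableSet_Ioi fun t ht => ?_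
    gcongr
    exact (hz_Kfun n0 n1 f hf Q t hq0 ht).1
  · rw [← lintegral_const_mul' _ _ (by simp [hq0.le])]
    refine setLIntegral_mono' measurableSet_Ioi fun t ht => ?_
    rw [mul_left_comm]
    gcongr
    exact (hz_Kfun n0 n1 f hf Q t hq0 ht).2

theorem hz_herz_pow {Y : Type*} [MeasurableSpace Y] [Norm Y] (ν : Measure Y) (Ω : Set Y) (a : ℝ)
    (p q r : ℝ≥0∞) (hq0 : 0 < q.toReal) (hq : q ≠ ∞) (f : Y → ℝ) :
    herzNorm ν Ω a p q r f ^ q.toReal = ∑' u : {u : ℤ // -1 ≤ u},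
      (ENNReal.ofReal ((2 : ℝ) ^ ((u.1 : ℝ) * a)) *
        lorentzNorm ν p r ((annulus Ω u.1).indicator f)) ^ q.toReal := by
  rw [herzNorm, herzNormWith, if_neg hq, ENNReal.rpow_inv_rpow hq0.ne']

theorem hz_ann_meas {Y : Type*} [MeasurableSpace Y] [NormedAddCommGroup Y] [OpensMeasurableSpace Y]
    (Ω : Set Y) (hΩ : MeasurableSet Ω) (u : ℤ) : MeasurableSet (annulus Ω u) := by
  unfold annulus
  split_ifs
  · exact hΩ.inter (measurableSet_lt measurable_norm measurable_const)
  · exact hΩ.inter ((measurableSet_le measurable_const measurable_norm).inter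
      (measurableSet_lt measurable_norm measurable_const))

theorem hz_ann_disj {Y : Type*} [Norm Y] (Ω : Set Y) (u v : ℤ) (hu : -1 ≤ u) (huv : u < v) :
    Disjoint (annulus Ω u) (annulus Ω v) := by
  rw [Set.disjoint_left]
  intro x hx hy
  have h1 : ‖x‖ < (2 : ℝ) ^ u := by
    unfold annulus at hx
    split_ifs at hx with h
    · have := hx.2
      rw [h]
      norm_num at this ⊢
      exact this
    · exact hx.2.2
  have h2 : (2 : ℝ) ^ (v - 1) ≤ ‖x‖ := by
    unfold annulus at hy
    rw [if_neg (by omega)] at hy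
    exact hy.2.1
  have h3 : (2 : ℝ) ^ u ≤ (2 : ℝ) ^ (v - 1) := zpow_le_zpow_right₀ (by norm_num) (by omega)
  linarith

theorem hz_glue {Y : Type*} [MeasurableSpace Y] [NormedAddCommGroup Y] [OpensMeasurableSpace Y]
    (Ω : Set Y) (hΩ : MeasurableSet Ω)
    (k : {u : ℤ // -1 ≤ u} → {g : Y → ℝ // Measurable g}) :
    ∃ i : {g : Y → ℝ // Measurable g}, ∀ u : {u : ℤ // -1 ≤ u},
      ∀ x ∈ annulus Ω u.1, i.1 x = (k u).1 x := by
  obtain ⟨g, hg, hgk⟩ := exists_measurable_piecewise (fun u : {u : ℤ // -1 ≤ u} => annulus Ω u.1)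
    (fun u => hz_ann_meas Ω hΩ u.1) (fun u => (k u).1) (fun u => (k u).2) (by
      intro u v huv x hx
      exfalso
      have hne : u.1 ≠ v.1 := fun h => huv (Subtype.ext h)
      rcases lt_or_gt_of_ne hne with h | h
      · exact Set.disjoint_left.1 (hz_ann_disj Ω _ _ u.2 h) hx.1 hx.2
      · exact Set.disjoint_left.1 (hz_ann_disj Ω _ _ v.2 h) hx.2 hx.1)
  exact ⟨⟨g, hg⟩, fun u x hx => hgk u hx⟩

theorem hz_conj (θ : ℝ) (hθ0 : 0 < θ) (hθ1 : θ < 1) (q q₀ q₁ : ℝ≥0∞)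
    (h0 : 0 < q₀) (h0' : q₀ ≠ ∞) (h1 : 0 < q₁)
    (hq : q⁻¹ = ENNReal.ofReal (1 - θ) * q₀⁻¹ + ENNReal.ofReal θ * q₁⁻¹) :
    0 < q.toReal ∧ q ≠ ∞ ∧
      q.toReal⁻¹ = (1 - θ) * q₀.toReal⁻¹ + θ * q₁.toReal⁻¹ := by
  have hi0 : q₀⁻¹ ≠ ∞ := ENNReal.inv_ne_top.2 h0.ne'
  have hi1 : q₁⁻¹ ≠ ∞ := ENNReal.inv_ne_top.2 h1.ne'
  have hm0 : ENNReal.ofReal (1 - θ) * q₀⁻¹ ≠ ∞ := ENNReal.mul_ne_top ENNReal.ofReal_ne_top hi0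
  have hm1 : ENNReal.ofReal θ * q₁⁻¹ ≠ ∞ := ENNReal.mul_ne_top ENNReal.ofReal_ne_top hi1
  have hqt : q⁻¹ ≠ ∞ := by rw [hq]; exact ENNReal.add_ne_top.2 ⟨hm0, hm1⟩
  have hq0 : q ≠ 0 := ENNReal.inv_ne_top.1 hqt
  have hq' : q ≠ ∞ := by
    rintro rfl
    rw [ENNReal.inv_top] at hq
    have := (add_eq_zero.1 hq.symm).1
    rcases mul_eq_zero.1 this with h | h
    · rw [ENNReal.ofReal_eq_zero] at h; linarith
    · exact h0' (ENNReal.inv_eq_zero.1 h)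
  refine ⟨ENNReal.toReal_pos hq0 hq', hq', ?_⟩
  have := congrArg ENNReal.toReal hq
  rw [ENNReal.toReal_add hm0 hm1, ENNReal.toReal_mul, ENNReal.toReal_mul, ENNReal.toReal_inv,
    ENNReal.toReal_inv, ENNReal.toReal_inv, ENNReal.toReal_ofReal (by linarith),
    ENNReal.toReal_ofReal hθ0.le] at this
  exact this

theorem hz_main {Y : Type*} [MeasurableSpace Y] [NormedAddCommGroup Y] [OpensMeasurableSpace Y]
    (ν : Measure Y) (Ω : Set Y) (hΩ : MeasurableSet Ω)
    (θ : ℝ) (hθ0 : 0 < θ) (hθ1 : θ < 1)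
    (q₀ q₁ : ℝ≥0∞) (hq₀0 : 0 < q₀) (hq₀ : q₀ ≠ ∞) (hq₁0 : 0 < q₁) (hq₁ : q₁ ≠ ∞)
    (p₀ p₁ : ℝ≥0∞) (hp₀ : 1 ≤ p₀) (hp₀₁ : p₀ < p₁)
    (a₀ a₁ a : ℝ) (ha : a = (1 - θ) * a₀ + θ * a₁)
    (p q : ℝ≥0∞)
    (hs : p.toReal⁻¹ = (1 - θ) * p₀.toReal⁻¹ + θ * p₁.toReal⁻¹)
    (hQ0 : 0 < q.toReal) (hqt : q ≠ ∞)
    (hQ : q.toReal⁻¹ = (1 - θ) * q₀.toReal⁻¹ + θ * q₁.toReal⁻¹) :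
    ∃ C1 C2 : ℝ≥0∞, C1 ≠ ∞ ∧ C2 ≠ ∞ ∧ ∀ f : Y → ℝ, Measurable f →
      herzNorm ν Ω a p q q f ^ q.toReal
          ≤ C1 * interpNorm (herzNorm ν Ω a₀ p₀ q₀ p₀)
              (herzNorm ν Ω a₁ p₁ q₁ p₁) θ q f ^ q.toReal
      ∧ interpNorm (herzNorm ν Ω a₀ p₀ q₀ p₀)
              (herzNorm ν Ω a₁ p₁ q₁ p₁) θ q f ^ q.toReal
          ≤ C2 * herzNorm ν Ω a p q q f ^ q.toReal := by
  have hp₀p : 0 < p₀ := lt_of_lt_of_le one_pos hp₀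
  have hp₀t : p₀ ≠ ∞ := hp₀₁.ne_top
  have hp₁p : 0 < p₁ := hp₀p.trans hp₀₁
  obtain ⟨δ, hδe⟩ : ∃ δ, δ = p₀.toReal⁻¹ - p₁.toReal⁻¹ := ⟨_, rfl⟩
  have hP0 : 0 < p₀.toReal := ENNReal.toReal_pos hp₀p.ne' hp₀t
  have hδ : 0 < δ := by
    rw [hδe, sub_pos]
    by_cases h : p₁ = ∞
    · simp [h, hP0]
    · exact inv_strictAnti₀ hP0 ((ENNReal.toReal_lt_toReal hp₀t h).2 hp₀₁)
  have hQ0' : 0 < q₀.toReal := ENNReal.toReal_pos hq₀0.ne' hq₀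
  have hQ1' : 0 < q₁.toReal := ENNReal.toReal_pos hq₁0.ne' hq₁
  obtain ⟨D2, hD2, hup⟩ := hz_block_upper ν p₀ p₁ hp₀p hp₀t hp₁p q.toReal θ p.toReal⁻¹ δ hQ0
    hθ0 hθ1 hδ hδe hs
  obtain ⟨D1, hD1, hlo⟩ := hz_block_lower ν p₀ p₁ hp₀p hp₁p q.toReal θ p.toReal⁻¹ δ hQ0 hδe hs
  set Q := q.toReal with hQdef
  set Q0 := q₀.toReal with hQ0def
  set Q1 := q₁.toReal with hQ1def
  obtain ⟨k, hk⟩ : ∃ k, k = ENNReal.ofReal (1 / (θ * δ)) := ⟨_, rfl⟩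
  have hk0 : k ≠ 0 := by rw [hk]; simp; positivity
  have hkt : k ≠ ∞ := by rw [hk]; simp
  obtain ⟨m, hm⟩ : ∃ m, m = ENNReal.ofReal (1 / θ) := ⟨_, rfl⟩
  have hm0 : m ≠ 0 := by rw [hm]; simp; positivity
  have hmt : m ≠ ∞ := by rw [hm]; simp
  refine ⟨D1 * k * 2 * m⁻¹, 2 ^ Q * m * 2 * k⁻¹ * D2, ?_, ?_, ?_⟩
  · exact ENNReal.mul_ne_top (ENNReal.mul_ne_top (ENNReal.mul_ne_top hD1 hkt) (by simp))
      (ENNReal.inv_ne_top.2 hm0)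
  · exact ENNReal.mul_ne_top (ENNReal.mul_ne_top (ENNReal.mul_ne_top (ENNReal.mul_ne_top
      (by simp [hQ0.le]) hmt) (by simp)) (ENNReal.inv_ne_top.2 hk0)) hD2
  intro f hf
  -- block quantities
  set A := fun u : {u : ℤ // -1 ≤ u} => annulus Ω u.1 with hA
  set w0 := fun u : {u : ℤ // -1 ≤ u} => (2 : ℝ) ^ ((u.1 : ℝ) * a₀) with hw0
  set w1 := fun u : {u : ℤ // -1 ≤ u} => (2 : ℝ) ^ ((u.1 : ℝ) * a₁) with hw1
  have hw0p : ∀ u, 0 < w0 u := fun u => by positivity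
  have hw1p : ∀ u, 0 < w1 u := fun u => by positivity
  set x0 := fun g : {g : Y → ℝ // Measurable g} => herzNorm ν Ω a₀ p₀ q₀ p₀ g.1 with hx0
  set x1 := fun g : {g : Y → ℝ // Measurable g} => herzNorm ν Ω a₁ p₁ q₁ p₁ (f - g.1) with hx1
  set y0 := fun (u : {u : ℤ // -1 ≤ u}) (g : {g : Y → ℝ // Measurable g}) =>
    ENNReal.ofReal (w0 u) * hzX0 ν p₀ (A u) g with hy0
  set y1 := fun (u : {u : ℤ // -1 ≤ u}) (g : {g : Y → ℝ // Measurable g}) =>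
    ENNReal.ofReal (w1 u) * hzX1 ν p₁ (A u) f g with hy1
  have : Nonempty {g : Y → ℝ // Measurable g} := ⟨⟨0, measurable_zero⟩⟩
  obtain ⟨hJ1, hJ2⟩ := hz_decJ x0 x1 y0 y1 Q0 Q1 hQ0' hQ1'
    (fun i => hz_herz_pow ν Ω a₀ p₀ q₀ p₀ hQ0' hq₀ i.1)
    (fun i => hz_herz_pow ν Ω a₁ p₁ q₁ p₁ hQ1' hq₁ (f - i.1))
    (by
      intro c
      obtain ⟨i, hi⟩ := hz_glue Ω hΩ c
      refine ⟨i, fun u => ?_⟩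
      have e0 : (A u).indicator i.1 = (A u).indicator (c u).1 :=
        Set.indicator_congr fun x hx => hi u x hx
      have e1 : (A u).indicator (f - i.1) = (A u).indicator (f - (c u).1) :=
        Set.indicator_congr fun x hx => by
          rw [Pi.sub_apply, Pi.sub_apply, hi u x hx]
      simp only [hy0, hy1, hzX0, hzX1, e0, e1, and_self])
    (θ * Q / Q1) (Q * (1 - θ)) (Q * θ) (by positivity)
    (by
      field_simp at hQ ⊢
      nlinarith)
    (by field_simp)
  obtain ⟨hI1, hI2⟩ := hz_interp (herzNorm ν Ω a₀ p₀ q₀ p₀) (herzNorm ν Ω a₁ p₁ q₁ p₁) f hf θ hθ0 q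
    hQ0 hqt
  rw [← hm] at hI1 hI2
  set J := hzJ x0 x1 (Q * (1 - θ)) (Q * θ) with hJ
  set I := interpNorm (herzNorm ν Ω a₀ p₀ q₀ p₀) (herzNorm ν Ω a₁ p₁ q₁ p₁) θ q f ^ Q with hI
  set Ju := fun u : {u : ℤ // -1 ≤ u} =>
    hzJ (hzX0 ν p₀ (A u)) (hzX1 ν p₁ (A u) f) (Q * (1 - θ)) (Q * θ) with hJu
  set W := fun u : {u : ℤ // -1 ≤ u} => ENNReal.ofReal ((2 : ℝ) ^ ((u.1 : ℝ) * a)) ^ Q with hW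
  have hJy : ∀ u, hzJ (y0 u) (y1 u) (Q * (1 - θ)) (Q * θ) = W u * Ju u := by
    intro u
    have h := hzJ_scale (hzX0 ν p₀ (A u)) (hzX1 ν p₁ (A u) f) (w0 u) (w1 u) (hw0p u) (hw1p u)
      (Q * (1 - θ)) (Q * θ) (by positivity)
    refine h.trans ?_
    simp only [hW, hJu]
    congr 1
    rw [ENNReal.ofReal_rpow_of_pos (by positivity)]
    congr 1
    simp only [hw0, hw1]
    rw [← Real.rpow_mul (by norm_num), ← Real.rpow_mul (by norm_num),
      ← Real.rpow_mul (by norm_num), ← Real.rpow_add (by norm_num), ha]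
    congr 1
    ring
  set L := fun u : {u : ℤ // -1 ≤ u} => ∫⁻ τ in Set.Ioi (0:ℝ),
    (ENNReal.ofReal (τ ^ p.toReal⁻¹) * rearr ν ((A u).indicator f) τ) ^ Q / ENNReal.ofReal τ with hL
  have hH : herzNorm ν Ω a p q q f ^ Q = ∑' u, W u * L u := by
    rw [hQdef, hz_herz_pow ν Ω a p q q hQ0 hqt f]
    refine tsum_congr fun u => ?_
    rw [ENNReal.mul_rpow_of_nonneg _ _ hQ0.le]
    simp only [hW, hL]
    rw [lorentzNorm, lorentzNormOf, if_neg hqt, ENNReal.rpow_inv_rpow hQ0.ne']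
  have hB : ∀ u, ∫⁻ τ in Set.Ioi (0:ℝ), ENNReal.ofReal (τ ^ (-(θ * Q * δ) - 1)) *
        hzM (hzX0 ν p₀ (A u)) (hzX1 ν p₁ (A u) f) Q Q (Q * δ) τ = k * Ju u := by
    intro u
    have h := hz_power (hzX0 ν p₀ (A u)) (hzX1 ν p₁ (A u) f) Q Q (Q * δ) (θ * Q * δ) hQ0 hQ0
      (by positivity) (by positivity)
    have e1 : Q / (θ * Q * δ) = 1 / (θ * δ) := by field_simp
    have e2 : Q * (1 - θ * Q * δ / (Q * δ)) = Q * (1 - θ) := by field_simp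
    have e3 : Q * (θ * Q * δ) / (Q * δ) = Q * θ := by field_simp
    rw [e1, e2, e3, ← hk] at h
    exact h
  have hup' : ∀ u, Ju u ≤ k⁻¹ * (D2 * L u) := by
    intro u
    have h := hup (A u) f (hz_ann_meas Ω hΩ u.1) hf
    rw [hB u] at h
    calc Ju u = k⁻¹ * (k * Ju u) := by rw [← mul_assoc, ENNReal.inv_mul_cancel hk0 hkt, one_mul]
      _ ≤ _ := by gcongr
  have hlo' : ∀ u, L u ≤ D1 * (k * Ju u) := by
    intro u
    have h := hlo (A u) f
    rw [hB u] at h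
    exact h
  simp only [hJy] at hJ1 hJ2
  rw [hH]
  constructor
  · calc ∑' u, W u * L u ≤ ∑' u, (D1 * k) * (W u * Ju u) := by
          refine ENNReal.tsum_le_tsum fun u => ?_
          calc W u * L u ≤ W u * (D1 * (k * Ju u)) := by gcongr; exact hlo' u
            _ = _ := by ring
      _ = D1 * k * ∑' u, W u * Ju u := ENNReal.tsum_mul_left
      _ ≤ D1 * k * (2 * J) := by gcongr
      _ = D1 * k * 2 * (m⁻¹ * (m * J)) := by
          rw [← mul_assoc m⁻¹, ENNReal.inv_mul_cancel hm0 hmt, one_mul, mul_assoc _ 2]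
      _ ≤ D1 * k * 2 * (m⁻¹ * I) := by gcongr
      _ = _ := by ring
  · calc I ≤ 2 ^ Q * (m * J) := hI2
      _ ≤ 2 ^ Q * (m * (2 * ∑' u, W u * Ju u)) := by gcongr
      _ ≤ 2 ^ Q * (m * (2 * ∑' u, (k⁻¹ * D2) * (W u * L u))) := by
          refine mul_le_mul_right (mul_le_mul_right (mul_le_mul_right
            (ENNReal.tsum_le_tsum fun u => ?_) _) _) _
          calc W u * Ju u ≤ W u * (k⁻¹ * (D2 * L u)) := by gcongr; exact hup' u
            _ = _ := by ring
      _ = _ := by rw [ENNReal.tsum_mul_left]; ring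

theorem hz_root (C x y : ℝ≥0∞) (Q : ℝ) (hQ : 0 < Q) (h : x ^ Q ≤ C * y ^ Q) :
    x ≤ C ^ Q⁻¹ * y := by
  have := ENNReal.rpow_le_rpow h (inv_nonneg.2 hQ.le)
  rwa [ENNReal.mul_rpow_of_nonneg _ _ (inv_nonneg.2 hQ.le), ENNReal.rpow_rpow_inv hQ.ne',
    ENNReal.rpow_rpow_inv hQ.ne'] at this

/-- (Interpolation of Herz spaces.) Let `0 < θ < 1`,
`0 < q₀, q₁ < ∞`, `1 ≤ p₀ < p₁ ≤ ∞`, `a = (1−θ)a₀ + θa₁`,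
`1/p = (1−θ)/p₀ + θ/p₁` and `1/q = (1−θ)/q₀ + θ/q₁`.  Then, up to equivalence
of quasi-norms on `X₀ + X₁`,
`(K^{a₀}_{p₀,q₀}, K^{a₁}_{p₁,q₁})_{θ,q} = HL^{a,q}_{p,q}`, where
`K^{a}_{p,q} = HL^{a,p}_{p,q}` is the non-homogeneous Herz space. -/
theorem herz_interp {N : ℕ} (hN : 1 ≤ N)
    (Ω : Set (Euc N)) (hΩ : MeasurableSet Ω)
    (θ : ℝ) (hθ0 : 0 < θ) (hθ1 : θ < 1)
    (q₀ q₁ : ℝ≥0∞) (hq₀0 : 0 < q₀) (hq₀ : q₀ ≠ ∞) (hq₁0 : 0 < q₁) (hq₁ : q₁ ≠ ∞)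
    (p₀ p₁ : ℝ≥0∞) (hp₀ : 1 ≤ p₀) (hp₀₁ : p₀ < p₁)
    (a₀ a₁ a : ℝ) (ha : a = (1 - θ) * a₀ + θ * a₁)
    (p q : ℝ≥0∞)
    (hp : p⁻¹ = ENNReal.ofReal (1 - θ) * p₀⁻¹ + ENNReal.ofReal θ * p₁⁻¹)
    (hq : q⁻¹ = ENNReal.ofReal (1 - θ) * q₀⁻¹ + ENNReal.ofReal θ * q₁⁻¹) :
    ∃ c C : ℝ≥0∞, 0 < c ∧ C < ∞ ∧ ∀ f : Euc N → ℝ, Measurable f →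
      inSum (herzNorm volume Ω a₀ p₀ q₀ p₀) (herzNorm volume Ω a₁ p₁ q₁ p₁) f →
      c * herzNorm volume Ω a p q q f
          ≤ interpNorm (herzNorm volume Ω a₀ p₀ q₀ p₀)
              (herzNorm volume Ω a₁ p₁ q₁ p₁) θ q f
      ∧ interpNorm (herzNorm volume Ω a₀ p₀ q₀ p₀)
              (herzNorm volume Ω a₁ p₁ q₁ p₁) θ q f
          ≤ C * herzNorm volume Ω a p q q f := by
  obtain ⟨hQ0, hqt, hQ⟩ := hz_conj θ hθ0 hθ1 q q₀ q₁ hq₀0 hq₀ hq₁0 hq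
  have hp₀p : 0 < p₀ := lt_of_lt_of_le one_pos hp₀
  obtain ⟨_, _, hs⟩ := hz_conj θ hθ0 hθ1 p p₀ p₁ hp₀p hp₀₁.ne_top (hp₀p.trans hp₀₁) hp
  obtain ⟨C1, C2, hC1, hC2, hmain⟩ := hz_main (volume : Measure (Euc N)) Ω hΩ θ hθ0 hθ1 q₀ q₁
    hq₀0 hq₀ hq₁0 hq₁ p₀ p₁ hp₀ hp₀₁ a₀ a₁ a ha p q hs hQ0 hqt hQ
  have hi : 0 ≤ q.toReal⁻¹ := inv_nonneg.2 hQ0.le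
  have hD : (C1 + 1) ^ q.toReal⁻¹ ≠ ∞ :=
    ENNReal.rpow_ne_top_of_nonneg hi (by simp [hC1])
  have hD0 : (C1 + 1) ^ q.toReal⁻¹ ≠ 0 := by
    have : 0 < (C1 + 1) ^ q.toReal⁻¹ :=
      ENNReal.rpow_pos (lt_of_lt_of_le one_pos le_add_self) (by simp [hC1])
    exact this.ne'
  refine ⟨((C1 + 1) ^ q.toReal⁻¹)⁻¹, C2 ^ q.toReal⁻¹, ENNReal.inv_pos.2 hD,
    (ENNReal.rpow_ne_top_of_nonneg hi hC2).lt_top, fun f hf _ => ⟨?_, ?_⟩⟩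
  · have h := hz_root (C1 + 1) _ _ q.toReal hQ0
      ((hmain f hf).1.trans (mul_le_mul_left le_self_add _))
    refine (mul_le_mul_right h _).trans ?_
    rw [← mul_assoc, ENNReal.inv_mul_cancel hD0 hD, one_mul]
  · exact hz_root C2 _ _ q.toReal hQ0 (hmain f hf).2
end

section
/- Let Ω = ℝ^N, 1 < p < ∞, 1 ≤ q, r ≤ ∞, let p' be the conjugate exponent of p, and let −N/p < a < N/p'. Let T be an operator mapping measurable functions on ℝ^N to measurable functions on ℝ^N such that: (sublinearity) for every countable decomposition f = Σ_j f_j of a measurable function into measurable pieces with disjoint supports, |Tf(x)| ≤ Σ_j |Tf_j(x)| for a.e. x; (size condition) there is C₀ such that for every f ∈ L¹(ℝ^N) with compact support and a.e. x outside the support of f, |Tf(x)| ≤ C₀ ∫_{ℝ^N} |f(y)|/|x−y|^N dμ(y); and (Lorentz boundedness) there is C₁ such that ‖Tf‖_{L^{p,r}} ≤ C₁ ‖f‖_{L^{p,r}} for all f ∈ L^{p,r}(ℝ^N). Then T is bounded on HL^{a,r}_{p,q}(ℝ^N): there exists a constant C such that ‖Tf‖_{HL^{a,r}_{p,q}} ≤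 C ‖f‖_{HL^{a,r}_{p,q}} for all f ∈ HL^{a,r}_{p,q}(ℝ^N). -/
open MeasureTheory ENNReal Set Filter Topology

/-- rearrangement of an extended nonnegative function -/
noncomputable def rearrE {X : Type*} [MeasurableSpace X] (μ : Measure X) (F : X → ℝ≥0∞) (s : ℝ) : ℝ≥0∞ :=
  sInf {α : ℝ≥0∞ | μ {x | α < F x} ≤ ENNReal.ofReal s}

theorem rearrE_mono {X : Type*} [MeasurableSpace X] {μ : Measure X} {F G : X → ℝ≥0∞}
    (h : ∀ᵐ x ∂μ, F x ≤ G x) (s : ℝ) : rearrE μ F s ≤ rearrE μ G s := by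
  apply sInf_le_sInf
  intro α hα
  refine le_trans (measure_mono_ae ?_) hα
  filter_upwards [h] with x hx h1
  exact lt_of_lt_of_le h1 hx

theorem rearrE_antitone {X : Type*} [MeasurableSpace X] (μ : Measure X) (F : X → ℝ≥0∞) :
    Antitone (rearrE μ F) := by
  intro s t hst
  apply sInf_le_sInf
  intro α hα
  exact le_trans hα (ENNReal.ofReal_le_ofReal hst)

theorem rearrE_add {X : Type*} [MeasurableSpace X] (μ : Measure X) (F G : X → ℝ≥0∞) {s : ℝ}
    (hs : 0 ≤ s) :
    rearrE μ (fun x => F x + G x) s ≤ rearrE μ F (s/2) + rearrE μ G (s/2) := by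
  unfold rearrE
  rw [ENNReal.sInf_add]
  refine le_iInf₂ fun α hα => ?_
  rw [add_comm, ENNReal.sInf_add]
  refine le_iInf₂ fun β hβ => ?_
  apply sInf_le
  have h1 : {x | β + α < F x + G x} ⊆ {x | α < F x} ∪ {x | β < G x} := by
    intro x hx
    by_contra hc
    simp only [mem_union, mem_setOf_eq, not_or, not_lt] at hc hx
    have := add_le_add hc.2 hc.1
    rw [add_comm (G x)] at this
    exact absurd hx (not_lt.mpr this)
  calc μ {x | β + α < F x + G x} ≤ μ {x | α < F x} + μ {x | β < G x} :=
        (measure_mono h1).trans (measure_union_le _ _)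
    _ ≤ ENNReal.ofReal (s/2) + ENNReal.ofReal (s/2) := add_le_add hα hβ
    _ = ENNReal.ofReal s := by
        rw [← ENNReal.ofReal_add (by linarith) (by linarith)]; congr 1; ring

theorem rearrE_const {X : Type*} [MeasurableSpace X] (μ : Measure X) (A : Set X) (G : ℝ≥0∞) {b : ℝ}
    (hb : μ A ≤ ENNReal.ofReal b) (s : ℝ) :
    rearrE μ (A.indicator fun _ => G) s ≤ if s < b then G else 0 := by
  split_ifs with h
  · apply sInf_le
    have : {x | G < A.indicator (fun _ => G) x} = ∅ := by
      ext x
      by_cases hx : x ∈ A <;> simp [hx]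
    simp [this]
  · apply sInf_le
    refine le_trans (measure_mono ?_) (hb.trans (ENNReal.ofReal_le_ofReal (not_lt.mp h)))
    intro x hx
    by_contra hc
    simp [hc] at hx

theorem meas_le_of_rearrE_lt {X : Type*} [MeasurableSpace X] (μ : Measure X) (F : X → ℝ≥0∞)
    {s : ℝ} {α : ℝ≥0∞} (h : rearrE μ F s < α) : μ {x | α < F x} ≤ ENNReal.ofReal s := by
  obtain ⟨β, hβ, hlt⟩ := sInf_lt_iff.mp h
  exact le_trans (measure_mono fun x hx => lt_trans hlt hx) hβ

theorem lorentzNormOf_mono {R S : ℝ → ℝ≥0∞} (p r : ℝ≥0∞) (h : ∀ t, 0 < t → R t ≤ S t) :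
    lorentzNormOf R p r ≤ lorentzNormOf S p r := by
  unfold lorentzNormOf
  split_ifs with hr
  · exact iSup_mono fun t => by gcongr; exact h _ t.2
  · refine ENNReal.rpow_le_rpow ?_ (by positivity)
    refine setLIntegral_mono' measurableSet_Ioi fun t ht => ?_
    gcongr
    exact h _ ht

theorem lorentzNormOf_add {R S : ℝ → ℝ≥0∞} (p : ℝ≥0∞) {r : ℝ≥0∞} (hr : 1 ≤ r)
    (hR : Measurable R) :
    lorentzNormOf (fun t => R t + S t) p r ≤ 2 * (lorentzNormOf R p r + lorentzNormOf S p r) := by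
  unfold lorentzNormOf
  split_ifs with hr'
  · refine le_trans (iSup_le fun t => ?_) (le_mul_of_one_le_left (zero_le) one_le_two)
    rw [mul_add]
    exact add_le_add (le_iSup (fun t : {t : ℝ // 0 < t} => ENNReal.ofReal (t.1 ^ p.toReal⁻¹) * R t.1) t)
      (le_iSup (fun t : {t : ℝ // 0 < t} => ENNReal.ofReal (t.1 ^ p.toReal⁻¹) * S t.1) t)
  · have hρ : 1 ≤ r.toReal := by
      rw [← ENNReal.toReal_one]; exact ENNReal.toReal_mono hr' hr
    have hρ0 : 0 < r.toReal := by linarith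
    set ρ := r.toReal
    set I1 := ∫⁻ t in Set.Ioi (0 : ℝ), (ENNReal.ofReal (t ^ p.toReal⁻¹) * R t) ^ ρ / ENNReal.ofReal t
    set I2 := ∫⁻ t in Set.Ioi (0 : ℝ), (ENNReal.ofReal (t ^ p.toReal⁻¹) * S t) ^ ρ / ENNReal.ofReal t
    have h1 : ∫⁻ t in Set.Ioi (0 : ℝ), (ENNReal.ofReal (t ^ p.toReal⁻¹) * (R t + S t)) ^ ρ / ENNReal.ofReal t
        ≤ 2 ^ ρ * (I1 + I2) := by
      have hm : Measurable fun t : ℝ => (ENNReal.ofReal (t ^ p.toReal⁻¹) * R t) ^ ρ / ENNReal.ofReal t := by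
        fun_prop
      rw [← lintegral_add_left hm, ← lintegral_const_mul' _ _ (by finiteness)]
      refine lintegral_mono fun t => ?_
      rw [mul_add, ← ENNReal.add_div, ← mul_div_assoc]
      gcongr
      refine (ENNReal.rpow_add_le_mul_rpow_add_rpow _ _ hρ).trans ?_
      gcongr
      · norm_num
      · linarith
    calc _ ≤ (2 ^ ρ * (I1 + I2)) ^ ρ⁻¹ := ENNReal.rpow_le_rpow h1 (by positivity)
      _ = 2 * (I1 + I2) ^ ρ⁻¹ := by
        rw [ENNReal.mul_rpow_of_nonneg _ _ (by positivity), ← ENNReal.rpow_mul,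
          mul_inv_cancel₀ hρ0.ne', ENNReal.rpow_one]
      _ ≤ _ := by
        gcongr
        exact ENNReal.rpow_add_le_add_rpow _ _ (by positivity) (inv_le_one_of_one_le₀ hρ)

theorem lintegral_Ioi_dilate {h : ℝ → ℝ≥0∞} (hm : Measurable h) :
    ∫⁻ t in Ioi (0:ℝ), h t = 2 * ∫⁻ t in Ioi (0:ℝ), h (2 * t) := by
  rw [← lintegral_indicator measurableSet_Ioi, ← lintegral_indicator measurableSet_Ioi]
  conv_lhs => rw [← Real.smul_map_volume_mul_left (two_ne_zero (α := ℝ))]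
  rw [lintegral_smul_measure, lintegral_map (hm.indicator measurableSet_Ioi) (by fun_prop)]
  simp only [smul_eq_mul]
  congr 1
  · simp
  · refine lintegral_congr fun t => ?_
    simp [indicator]

theorem lorentzNormOf_dilate {R : ℝ → ℝ≥0∞} {p : ℝ≥0∞} (hp : 1 ≤ p.toReal) {r : ℝ≥0∞} (hr : 1 ≤ r)
    (hR : Measurable R) :
    lorentzNormOf (fun t => R (t / 2)) p r ≤ 2 * lorentzNormOf R p r := by
  have key : ∀ s : ℝ, 0 < s → ENNReal.ofReal ((2 * s) ^ p.toReal⁻¹) ≤ 2 * ENNReal.ofReal (s ^ p.toReal⁻¹) := by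
    intro s hs
    rw [show (2 : ℝ≥0∞) = ENNReal.ofReal 2 by simp, ← ENNReal.ofReal_mul (by norm_num)]
    apply ENNReal.ofReal_le_ofReal
    rw [Real.mul_rpow (by norm_num) hs.le]
    gcongr
    calc (2:ℝ) ^ p.toReal⁻¹ ≤ 2 ^ (1:ℝ) :=
          Real.rpow_le_rpow_of_exponent_le (by norm_num) (inv_le_one_of_one_le₀ hp)
      _ = 2 := by simp
  unfold lorentzNormOf
  split_ifs with hr'
  · refine iSup_le fun t => ?_
    have h2 : 0 < t.1 / 2 := by have := t.2; linarith
    have := key (t.1/2) h2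
    rw [mul_div_cancel₀ _ (two_ne_zero)] at this
    calc _ ≤ 2 * ENNReal.ofReal ((t.1 / 2) ^ p.toReal⁻¹) * R (t.1 / 2) := by gcongr
      _ ≤ _ := by
        rw [mul_assoc]
        gcongr
        exact le_iSup (fun t : {t : ℝ // 0 < t} => ENNReal.ofReal (t.1 ^ p.toReal⁻¹) * R t.1) ⟨t.1/2, h2⟩
  · have hρ : 1 ≤ r.toReal := by
      rw [← ENNReal.toReal_one]; exact ENNReal.toReal_mono hr' hr
    have hρ0 : 0 < r.toReal := by linarith
    set ρ := r.toReal
    set I1 := ∫⁻ t in Set.Ioi (0 : ℝ), (ENNReal.ofReal (t ^ p.toReal⁻¹) * R t) ^ ρ / ENNReal.ofReal t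
    have h1 : ∫⁻ t in Set.Ioi (0 : ℝ), (ENNReal.ofReal (t ^ p.toReal⁻¹) * R (t / 2)) ^ ρ / ENNReal.ofReal t
        ≤ 2 ^ ρ * I1 := by
      rw [lintegral_Ioi_dilate (by fun_prop), ← lintegral_const_mul' _ _ (by finiteness),
        ← lintegral_const_mul' _ _ (by finiteness)]
      refine setLIntegral_mono' measurableSet_Ioi fun t ht => ?_
      rw [mul_div_cancel_left₀ _ (two_ne_zero), ENNReal.ofReal_mul (by norm_num : (0:ℝ) ≤ 2)]
      have e : (2:ℝ≥0∞) * ((ENNReal.ofReal ((2 * t) ^ p.toReal⁻¹) * R t) ^ ρ / (ENNReal.ofReal 2 * ENNReal.ofReal t))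
        = (ENNReal.ofReal ((2 * t) ^ p.toReal⁻¹) * R t) ^ ρ / ENNReal.ofReal t := by
        rw [← mul_div_assoc]
        simp only [ENNReal.ofReal_ofNat]
        rw [ENNReal.mul_div_mul_left _ _ (by norm_num) (by norm_num)]
      rw [e, ← mul_div_assoc, ← ENNReal.mul_rpow_of_nonneg _ _ hρ0.le, ← mul_assoc]
      gcongr
      exact key t ht
    calc _ ≤ (2 ^ ρ * I1) ^ ρ⁻¹ := ENNReal.rpow_le_rpow h1 (by positivity)
      _ = 2 * I1 ^ ρ⁻¹ := by
        rw [ENNReal.mul_rpow_of_nonneg _ _ (by positivity), ← ENNReal.rpow_mul,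
          mul_inv_cancel₀ hρ0.ne', ENNReal.rpow_one]

theorem lint_rpow {b c : ℝ} (hb : 0 < b) (hc : 0 < c) :
    ∫⁻ t in Ioo (0:ℝ) b, ENNReal.ofReal (t ^ (c - 1)) = ENNReal.ofReal (b ^ c / c) := by
  have h1 : IntervalIntegrable (fun x : ℝ => x ^ (c-1)) volume 0 b :=
    intervalIntegral.intervalIntegrable_rpow' (by linarith)
  rw [intervalIntegrable_iff_integrableOn_Ioo_of_le hb.le] at h1
  rw [← ofReal_integral_eq_lintegral_ofReal h1]
  · rw [← integral_Ioc_eq_integral_Ioo, ← intervalIntegral.integral_of_le hb.le, integral_rpow (by left; linarith)]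
    simp [Real.zero_rpow hc.ne']
  · filter_upwards [ae_restrict_mem measurableSet_Ioo] with t ht
    exact Real.rpow_nonneg ht.1.le _

theorem lorentzNormOf_step_aux {p : ℝ≥0∞} (hp : 1 ≤ p.toReal) {r : ℝ≥0∞} (hr : 1 ≤ r) (hr' : r ≠ ∞) :
    ∃ K : ℝ≥0∞, K ≠ 0 ∧ K ≠ ∞ ∧ ∀ (G : ℝ≥0∞) (b : ℝ), 0 < b →
      lorentzNormOf (fun t => if t < b then G else 0) p r = K * (ENNReal.ofReal (b ^ p.toReal⁻¹) * G) := by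
  have hρ : 1 ≤ r.toReal := by
    rw [← ENNReal.toReal_one]; exact ENNReal.toReal_mono hr' hr
  have hρ0 : 0 < r.toReal := by linarith
  unfold lorentzNormOf
  simp only [hr', if_false]
  set ρ := r.toReal
  set P := p.toReal
  have hP : 0 < P := by linarith
  refine ⟨ENNReal.ofReal (P / ρ) ^ ρ⁻¹, ?_, ?_, ?_⟩
  · have : 0 < ENNReal.ofReal (P/ρ) := by rw [ENNReal.ofReal_pos]; positivity
    exact (ENNReal.rpow_pos this (by finiteness)).ne'
  · finiteness
  · intro G b hb
    have h1 : ∫⁻ t in Ioi (0:ℝ), (ENNReal.ofReal (t ^ P⁻¹) * if t < b then G else 0) ^ ρ / ENNReal.ofReal t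
       = G ^ ρ * ENNReal.ofReal (b ^ (ρ / P) / (ρ / P)) := by
      rw [← lint_rpow hb (by positivity), ← lintegral_const_mul _ (by fun_prop),
        ← lintegral_indicator measurableSet_Ioi, ← lintegral_indicator measurableSet_Ioo]
      refine lintegral_congr fun t => ?_
      by_cases ht : 0 < t
      · by_cases htb : t < b
        · simp only [indicator, mem_Ioi, ht, mem_Ioo, htb, if_true, and_self]
          rw [ENNReal.mul_rpow_of_nonneg _ _ hρ0.le, ENNReal.ofReal_rpow_of_pos (by positivity),
            mul_comm, mul_div_assoc, ← ENNReal.ofReal_div_of_pos ht, ← Real.rpow_mul ht.le,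
            Real.rpow_sub ht, Real.rpow_one, inv_mul_eq_div]
        · simp [indicator, ht, htb, hρ0]
      · simp [indicator, ht]
    rw [h1, ENNReal.mul_rpow_of_nonneg _ _ (by positivity), ← ENNReal.rpow_mul,
          mul_inv_cancel₀ hρ0.ne', ENNReal.rpow_one, div_div_eq_mul_div, mul_div_assoc,
          ENNReal.ofReal_mul (by positivity), ENNReal.mul_rpow_of_nonneg _ _ (by positivity),
          ENNReal.ofReal_rpow_of_pos (by positivity : 0 < b ^ (ρ/P)), ← Real.rpow_mul hb.le]
    have : ρ / P * ρ⁻¹ = P⁻¹ := by field_simp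
    rw [this]; ring

theorem lorentzNormOf_step {p : ℝ≥0∞} (hp : 1 ≤ p.toReal) {r : ℝ≥0∞} (hr : 1 ≤ r) :
    ∃ K : ℝ≥0∞, K ≠ ∞ ∧ ∀ (G : ℝ≥0∞) (b : ℝ), 0 < b →
      lorentzNormOf (fun t => if t < b then G else 0) p r ≤ K * (ENNReal.ofReal (b ^ p.toReal⁻¹) * G) := by
  by_cases hr' : r = ∞
  · refine ⟨1, by simp, fun G b hb => ?_⟩
    simp only [lorentzNormOf, hr', if_true, one_mul]
    refine iSup_le fun t => ?_
    split_ifs with h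
    · gcongr
      exact t.2.le
    · simp
  · obtain ⟨K, -, h2, h3⟩ := lorentzNormOf_step_aux hp hr hr'
    exact ⟨K, h2, fun G b hb => (h3 G b hb).le⟩

theorem lorentzNormOf_weak {p : ℝ≥0∞} (hp : 1 ≤ p.toReal) {r : ℝ≥0∞} (hr : 1 ≤ r) :
    ∃ K : ℝ≥0∞, K ≠ ∞ ∧ ∀ (R : ℝ → ℝ≥0∞), Antitone R → ∀ t : ℝ, 0 < t →
      ENNReal.ofReal (t ^ p.toReal⁻¹) * R t ≤ K * lorentzNormOf R p r := by
  by_cases hr' : r = ∞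
  · refine ⟨1, by simp, fun R hR t ht => ?_⟩
    simp only [lorentzNormOf, hr', if_true, one_mul]
    exact le_iSup (fun t : {t : ℝ // 0 < t} => ENNReal.ofReal (t.1 ^ p.toReal⁻¹) * R t.1) ⟨t, ht⟩
  · obtain ⟨K, h1, h2, h3⟩ := lorentzNormOf_step_aux hp hr hr'
    refine ⟨K⁻¹, by simpa using h1, fun R hR t ht => ?_⟩
    have h4 : lorentzNormOf (fun s => if s < t then R t else 0) p r ≤ lorentzNormOf R p r := by
      apply lorentzNormOf_mono
      intro s hs
      split_ifs with h
      · exact hR h.le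
      · simp
    rw [h3 _ _ ht] at h4
    calc _ = K⁻¹ * (K * (ENNReal.ofReal (t ^ p.toReal⁻¹) * R t)) := by
          rw [← mul_assoc, ENNReal.inv_mul_cancel h1 h2, one_mul]
      _ ≤ _ := by gcongr

theorem lorentzE_add {X : Type*} [MeasurableSpace X] (μ : Measure X) (F G : X → ℝ≥0∞)
    {p : ℝ≥0∞} (hp : 1 ≤ p.toReal) {r : ℝ≥0∞} (hr : 1 ≤ r) :
    lorentzNormOf (rearrE μ (fun x => F x + G x)) p r
      ≤ 4 * (lorentzNormOf (rearrE μ F) p r + lorentzNormOf (rearrE μ G) p r) := by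
  have mF := (rearrE_antitone μ F).measurable
  have mG := (rearrE_antitone μ G).measurable
  calc _ ≤ lorentzNormOf (fun t => rearrE μ F (t/2) + rearrE μ G (t/2)) p r :=
        lorentzNormOf_mono _ _ fun t ht => rearrE_add μ F G ht.le
    _ ≤ 2 * (lorentzNormOf (fun t => rearrE μ F (t/2)) p r
          + lorentzNormOf (fun t => rearrE μ G (t/2)) p r) :=
        lorentzNormOf_add (R := fun t => rearrE μ F (t/2)) p hr (by fun_prop)
    _ ≤ 2 * (2 * lorentzNormOf (rearrE μ F) p r + 2 * lorentzNormOf (rearrE μ G) p r) := by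
        gcongr
        · exact lorentzNormOf_dilate hp hr mF
        · exact lorentzNormOf_dilate hp hr mG
    _ = _ := by ring

theorem lint_of_weak {X : Type*} [MeasurableSpace X] {μ : Measure X} {f : X → ℝ}
    (hf : Measurable f) {A : Set X} (hA : ∀ x, x ∉ A → f x = 0) {V : ℝ} (hV : 0 < V)
    (hAV : μ A ≤ ENNReal.ofReal V) {P M : ℝ} (hP : 1 < P) (hM : 0 < M)
    (h : ∀ t : ℝ, 0 < t → ENNReal.ofReal (t ^ P⁻¹) * rearr μ f t ≤ ENNReal.ofReal M) :
    ∫⁻ x, ENNReal.ofReal |f x| ∂μ ≤ ENNReal.ofReal (M * V ^ (1 - P⁻¹) * (1 + 2 ^ P / (P - 1))) := by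
  have hP0 : 0 < P := by linarith
  set α0 : ℝ := M * V ^ (-P⁻¹) with hα0
  have hα0p : 0 < α0 := by positivity
  rw [lintegral_eq_lintegral_meas_lt μ (ae_of_all _ fun x => abs_nonneg _) (by fun_prop),
    ← Ioc_union_Ioi_eq_Ioi hα0p.le]
  refine (lintegral_union_le _ _ _).trans ?_
  have h1 : ∫⁻ t in Ioc 0 α0, μ {a | t < |f a|} ≤ ENNReal.ofReal (M * V ^ (1 - P⁻¹)) := by
    calc _ ≤ ∫⁻ t in Ioc 0 α0, ENNReal.ofReal V := by
          refine setLIntegral_mono' measurableSet_Ioc fun t ht => ?_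
          refine le_trans (measure_mono fun x hx => ?_) hAV
          by_contra hc
          rw [mem_ofPred_eq, hA x hc, abs_zero] at hx
          exact absurd hx (not_lt.mpr ht.1.le)
      _ = ENNReal.ofReal (V * α0) := by
          rw [setLIntegral_const, Real.volume_Ioc, sub_zero, ENNReal.ofReal_mul hV.le]
      _ = _ := by
          congr 1
          rw [hα0, sub_eq_add_neg, Real.rpow_add hV, Real.rpow_one]; ring
  have h2 : ∫⁻ t in Ioi α0, μ {a | t < |f a|} ≤ ENNReal.ofReal (M * V ^ (1 - P⁻¹) * (2 ^ P / (P - 1))) := by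
    calc _ ≤ ∫⁻ t in Ioi α0, ENNReal.ofReal ((2 * M) ^ P * t ^ (-P)) := by
          refine setLIntegral_mono' measurableSet_Ioi fun t ht => ?_
          have ht0 : 0 < t := hα0p.trans ht
          have hs : 0 < (2 * M / t) ^ P := by positivity
          have h3 := h _ hs
          rw [← Real.rpow_mul (by positivity), mul_inv_cancel₀ hP0.ne', Real.rpow_one] at h3
          have h4 : rearr μ f ((2 * M / t) ^ P) ≤ ENNReal.ofReal (t / 2) := by
            have hpos : 0 < ENNReal.ofReal (2 * M / t) := by
              rw [ENNReal.ofReal_pos]; positivity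
            rw [← ENNReal.mul_le_mul_iff_right hpos.ne' (by finiteness)]
            refine h3.trans (le_of_eq ?_)
            rw [← ENNReal.ofReal_mul (by positivity)]
            congr 1; field_simp
          have h5 := meas_le_of_rearrE_lt μ (fun x => ENNReal.ofReal |f x|)
            (s := (2 * M / t) ^ P) (α := ENNReal.ofReal t)
            (lt_of_le_of_lt h4 ((ENNReal.ofReal_lt_ofReal_iff ht0).mpr (by linarith)))
          rw [Real.rpow_neg ht0.le, ← div_eq_mul_inv, ← Real.div_rpow (by positivity) ht0.le]
          refine le_trans (measure_mono fun x hx => ?_) h5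
          exact (ENNReal.ofReal_lt_ofReal_iff_of_nonneg ht0.le).mpr hx
      _ = ENNReal.ofReal ((2 * M) ^ P * (-α0 ^ (-P + 1) / (-P + 1))) := by
          rw [← integral_Ioi_rpow_of_lt (by linarith) hα0p, ← integral_const_mul,
            ofReal_integral_eq_lintegral_ofReal]
          · exact (integrableOn_Ioi_rpow_of_lt (by linarith) hα0p).const_mul _
          · filter_upwards [ae_restrict_mem measurableSet_Ioi] with t ht
            have ht0 : 0 < t := hα0p.trans ht
            positivity
      _ = _ := by
          congr 1
          have e1 : α0 ^ (-P + 1) = M ^ (-P) * M * V ^ (1 - P⁻¹) := by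
            rw [hα0, Real.mul_rpow hM.le (by positivity), ← Real.rpow_mul hV.le, Real.rpow_add hM,
              Real.rpow_one]
            congr 2
            field_simp
            ring
          rw [e1, Real.mul_rpow (by norm_num) hM.le, Real.rpow_neg hM.le,
            show -P + 1 = -(P - 1) by ring, neg_div_neg_eq]
          have : P - 1 ≠ 0 := by linarith
          have := (Real.rpow_pos_of_pos hM P).ne'
          field_simp
  refine (add_le_add h1 h2).trans (le_of_eq ?_)
  have : 0 < P - 1 := by linarith
  rw [← ENNReal.ofReal_add (by positivity) (by positivity)]
  congr 1; ring

theorem lint_le_lorentz {p : ℝ≥0∞} (hp : 1 < p.toReal) {r : ℝ≥0∞} (hr : 1 ≤ r) :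
    ∃ K : ℝ≥0∞, K ≠ ∞ ∧ ∀ (X : Type) [MeasurableSpace X] (μ : Measure X) (f : X → ℝ)
    (_ : Measurable f) (A : Set X) (_ : ∀ x, x ∉ A → f x = 0) (V : ℝ) (_ : 0 < V)
    (_ : μ A ≤ ENNReal.ofReal V) (_ : lorentzNorm μ p r f < ∞),
    ∫⁻ x, ENNReal.ofReal |f x| ∂μ ≤ K * (ENNReal.ofReal (V ^ (1 - p.toReal⁻¹)) * lorentzNorm μ p r f) := by
  obtain ⟨K, hK, hw⟩ := lorentzNormOf_weak hp.le hr
  set P := p.toReal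
  have hP1 : 0 < P - 1 := by linarith
  refine ⟨ENNReal.ofReal (1 + 2 ^ P / (P - 1)) * K, by finiteness, ?_⟩
  intro X _ μ f hf A hA V hV hAV hL
  have hW := hw (rearr μ f) (rearrE_antitone μ (fun x => ENNReal.ofReal |f x|))
  change ∀ t : ℝ, 0 < t → _ ≤ K * lorentzNorm μ p r f at hW
  have hWf : K * lorentzNorm μ p r f ≠ ∞ := ENNReal.mul_ne_top hK hL.ne
  have e : ENNReal.ofReal (1 + 2 ^ P / (P - 1)) * K * (ENNReal.ofReal (V ^ (1 - P⁻¹)) * lorentzNorm μ p r f)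
     = ENNReal.ofReal (V ^ (1 - P⁻¹) * (1 + 2 ^ P / (P - 1))) * (K * lorentzNorm μ p r f) := by
    rw [ENNReal.ofReal_mul (by positivity)]; ring
  rw [e]
  set W := K * lorentzNorm μ p r f
  set c := V ^ (1 - P⁻¹) * (1 + 2 ^ P / (P - 1)) with hc
  have hcp : 0 < c := by positivity
  refine ENNReal.le_of_forall_pos_le_add fun ε hε _ => ?_
  have hε' : (0:ℝ) < ε := hε
  have hε2 : 0 < (ε : ℝ) / c := by positivity
  have := lint_of_weak hf hA hV hAV hp (M := W.toReal + ε / c) (by positivity) (by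
    intro t ht
    refine (hW t ht).trans ?_
    rw [ENNReal.ofReal_add (by positivity) (by positivity), ENNReal.ofReal_toReal hWf]
    exact le_self_add)
  refine this.trans (le_of_eq ?_)
  rw [mul_assoc, ← hc, add_mul, div_mul_cancel₀ _ hcp.ne', ENNReal.ofReal_add (by positivity) (by positivity),
    ENNReal.ofReal_mul (by positivity), ENNReal.ofReal_toReal hWf, mul_comm, ENNReal.ofReal_coe_nnreal]

/-- sequence-space norm -/
noncomputable def lqn (q : ℝ≥0∞) (x : ℕ → ℝ≥0∞) : ℝ≥0∞ :=
  if q = ∞ then ⨆ n, x n else (∑' n, x n ^ q.toReal) ^ q.toReal⁻¹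

theorem schur_lq {q : ℝ≥0∞} (hq : 1 ≤ q) (k : ℕ → ℕ → ℝ≥0∞) (S C : ℝ≥0∞)
    (hrow : ∀ m, ∑' n, k m n ≤ S) (hcol : ∀ n, ∑' m, k m n ≤ S) (x y : ℕ → ℝ≥0∞)
    (hxy : ∀ m, y m ≤ C * ∑' n, k m n * x n) : lqn q y ≤ C * S * lqn q x := by
  unfold lqn
  split_ifs with hq'
  · refine iSup_le fun m => (hxy m).trans ?_
    rw [mul_assoc]
    gcongr
    calc ∑' n, k m n * x n ≤ ∑' n, k m n * ⨆ n, x n := by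
          gcongr with n
          exact le_iSup x n
      _ ≤ _ := by
        rw [ENNReal.tsum_mul_right]
        gcongr
        exact hrow m
  · have hρ : 1 ≤ q.toReal := by
      rw [← ENNReal.toReal_one]; exact ENNReal.toReal_mono hq' hq
    have hρ0 : 0 < q.toReal := by linarith
    set ρ := q.toReal
    have hρi : ρ⁻¹ ≤ 1 := inv_le_one_of_one_le₀ hρ
    have h1 : ∀ m, ∑' n, k m n * x n ≤ S ^ (1 - ρ⁻¹) * (∑' n, k m n * x n ^ ρ) ^ ρ⁻¹ := by
      intro m
      rw [ENNReal.tsum_eq_iSup_sum]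
      refine iSup_le fun s => (ENNReal.inner_le_weight_mul_Lp_of_nonneg s hρ _ _).trans ?_
      gcongr
      · exact (ENNReal.sum_le_tsum s).trans (hrow m)
      · exact ENNReal.sum_le_tsum s
    have h2 : ∀ m, y m ^ ρ ≤ (C ^ ρ * S ^ (ρ - 1)) * ∑' n, k m n * x n ^ ρ := by
      intro m
      calc y m ^ ρ ≤ (C * (S ^ (1 - ρ⁻¹) * (∑' n, k m n * x n ^ ρ) ^ ρ⁻¹)) ^ ρ := by
            gcongr
            exact (hxy m).trans (by gcongr; exact h1 m)
        _ = _ := by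
            rw [ENNReal.mul_rpow_of_nonneg _ _ hρ0.le, ENNReal.mul_rpow_of_nonneg _ _ hρ0.le,
              ← ENNReal.rpow_mul, ← ENNReal.rpow_mul, inv_mul_cancel₀ hρ0.ne', ENNReal.rpow_one,
              sub_mul, inv_mul_cancel₀ hρ0.ne', one_mul, mul_assoc]
    have h3 : ∑' m, y m ^ ρ ≤ (C * S) ^ ρ * ∑' n, x n ^ ρ := by
      calc ∑' m, y m ^ ρ ≤ ∑' m, (C ^ ρ * S ^ (ρ - 1)) * ∑' n, k m n * x n ^ ρ :=
            ENNReal.tsum_le_tsum h2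
        _ = (C ^ ρ * S ^ (ρ - 1)) * ∑' n, (∑' m, k m n) * x n ^ ρ := by
            rw [ENNReal.tsum_mul_left, ENNReal.tsum_comm]
            simp_rw [ENNReal.tsum_mul_right]
        _ ≤ (C ^ ρ * S ^ (ρ - 1)) * ∑' n, S * x n ^ ρ := by
            gcongr with n
            exact hcol n
        _ = C ^ ρ * (S ^ (ρ - 1) * S ^ (1:ℝ)) * ∑' n, x n ^ ρ := by
            rw [ENNReal.tsum_mul_left, ENNReal.rpow_one]; ring
        _ = _ := by
            rw [← ENNReal.rpow_add_of_nonneg _ _ (by linarith) (by norm_num), sub_add_cancel,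
              ENNReal.mul_rpow_of_nonneg _ _ hρ0.le]
    calc _ ≤ ((C * S) ^ ρ * ∑' n, x n ^ ρ) ^ ρ⁻¹ := by gcongr
      _ = _ := by
        rw [ENNReal.mul_rpow_of_nonneg _ _ (by positivity), ← ENNReal.rpow_mul,
          mul_inv_cancel₀ hρ0.ne', ENNReal.rpow_one]

theorem lqn_term_lt_top {q : ℝ≥0∞} (hq : 1 ≤ q) {x : ℕ → ℝ≥0∞} (h : lqn q x < ∞) (n : ℕ) : x n < ∞ := by
  unfold lqn at h
  split_ifs at h with hq'
  · exact lt_of_le_of_lt (le_iSup x n) h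
  · have hρ : 1 ≤ q.toReal := by
      rw [← ENNReal.toReal_one]; exact ENNReal.toReal_mono hq' hq
    have hρ0 : 0 < q.toReal := by linarith
    rw [ENNReal.rpow_lt_top_iff_of_pos (by positivity)] at h
    have := lt_of_le_of_lt (ENNReal.le_tsum n) h
    rwa [ENNReal.rpow_lt_top_iff_of_pos hρ0] at this

theorem geom_kernel {ρ : ℝ} (h0 : 0 < ρ) (h1 : ρ < 1) : ∃ S : ℝ≥0∞, S ≠ ∞ ∧
    (∀ m : ℕ, ∑' n : ℕ, ENNReal.ofReal (ρ ^ ((m : ℤ) - n).natAbs) ≤ S) ∧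
    (∀ n : ℕ, ∑' m : ℕ, ENNReal.ofReal (ρ ^ ((m : ℤ) - n).natAbs) ≤ S) := by
  have hs : Summable fun j : ℤ => ρ ^ j.natAbs := by
    apply Summable.of_nat_of_neg <;> simpa using summable_geometric_of_lt_one h0.le h1
  refine ⟨∑' j : ℤ, ENNReal.ofReal (ρ ^ j.natAbs), hs.tsum_ofReal_ne_top, fun m => ?_, fun n => ?_⟩
  · exact ENNReal.tsum_comp_le_tsum_of_injective (f := fun n : ℕ => (m:ℤ) - n)
      (fun a b h => by simp at h; exact_mod_cast h) (fun j : ℤ => ENNReal.ofReal (ρ ^ j.natAbs))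
  · exact ENNReal.tsum_comp_le_tsum_of_injective (f := fun m : ℕ => (m:ℤ) - n)
      (fun a b h => by simp at h; exact_mod_cast h) (fun j : ℤ => ENNReal.ofReal (ρ ^ j.natAbs))

/-- the index bijection -/
def eIdx : ℕ ≃ {u : ℤ // -1 ≤ u} where
  toFun n := ⟨(n : ℤ) - 1, by omega⟩
  invFun u := (u.1 + 1).toNat
  left_inv n := by simp
  right_inv u := by
    have := u.2
    ext
    simp only
    omega

/-- annuli indexed by naturals -/
def Bn (N : ℕ) (n : ℕ) : Set (Euc N) := annulus (Set.univ : Set (Euc N)) ((n : ℤ) - 1)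

theorem herzNorm_eq {N : ℕ} (a : ℝ) (p q r : ℝ≥0∞) (f : Euc N → ℝ) :
    herzNorm volume (Set.univ : Set (Euc N)) a p q r f
     = lqn q fun n => ENNReal.ofReal ((2 : ℝ) ^ (((n : ℝ) - 1) * a)) *
        lorentzNorm volume p r ((Bn N n).indicator f) := by
  unfold herzNorm herzNormWith lqn
  split_ifs with hq
  · rw [← eIdx.iSup_comp]
    simp [eIdx, Bn]
  · rw [← eIdx.tsum_eq]
    simp [eIdx, Bn]

theorem mem_Bn {N n : ℕ} {x : Euc N} : x ∈ Bn N n ↔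
    (n = 0 ∨ (2:ℝ) ^ ((n:ℝ) - 2) ≤ ‖x‖) ∧ ‖x‖ < (2:ℝ) ^ ((n:ℝ) - 1) := by
  unfold Bn annulus
  rcases Nat.eq_zero_or_pos n with rfl | hn
  · simp [Real.rpow_neg_one]
  · have h1 : ¬ ((n:ℤ) - 1 = -1) := by omega
    have e1 : (2:ℝ) ^ ((n:ℝ) - 2) = 2 ^ ((n:ℤ) - 1 - 1) := by
      rw [← Real.rpow_intCast]; push_cast; ring_nf
    have e2 : (2:ℝ) ^ ((n:ℝ) - 1) = 2 ^ ((n:ℤ) - 1) := by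
      rw [← Real.rpow_intCast]; push_cast; ring_nf
    rw [if_neg h1, e1, e2]
    simp [hn.ne']

theorem Bn_meas (N n : ℕ) : MeasurableSet (Bn N n) := by
  have : Bn N n = {x | n = 0 ∨ (2:ℝ) ^ ((n:ℝ) - 2) ≤ ‖x‖} ∩ {x | ‖x‖ < (2:ℝ) ^ ((n:ℝ) - 1)} := by
    ext x; exact mem_Bn
  rw [this]
  refine MeasurableSet.inter ?_ (measurableSet_lt measurable_norm measurable_const)
  exact (MeasurableSet.const (n = 0)).union
    (measurableSet_le (f := fun _ : Euc N => (2:ℝ) ^ ((n:ℝ) - 2)) measurable_const measurable_norm)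

theorem Bn_dist {N m n : ℕ} (h : 2 ≤ ((m:ℤ) - n).natAbs) {x y : Euc N} (hx : x ∈ Bn N m)
    (hy : y ∈ Bn N n) : (2:ℝ) ^ ((max m n : ℕ) - 3 : ℝ) ≤ ‖x - y‖ := by
  have key : ∀ {m n : ℕ} {x y : Euc N}, n + 2 ≤ m → x ∈ Bn N m → y ∈ Bn N n →
      (2:ℝ) ^ ((m:ℝ) - 3) ≤ ‖x - y‖ := by
    intro m n x y h hx hy
    rw [mem_Bn] at hx hy
    have h1 := hx.1.resolve_left (by omega)
    have h2 : (2:ℝ) ^ ((n:ℝ) - 1) ≤ 2 ^ ((m:ℝ) - 3) := by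
      apply Real.rpow_le_rpow_of_exponent_le (by norm_num)
      have : (n:ℝ) + 2 ≤ m := by exact_mod_cast h
      linarith
    have h3 : (2:ℝ) ^ ((m:ℝ) - 2) = 2 * 2 ^ ((m:ℝ) - 3) := by
      rw [show (m:ℝ) - 2 = 1 + (m - 3) by ring, Real.rpow_add (by norm_num), Real.rpow_one]
    have := norm_sub_norm_le x y
    linarith [hy.2]
  rcases le_total n m with hnm | hnm
  · rw [max_eq_left hnm]; exact key (by omega) hx hy
  · rw [max_eq_right hnm, norm_sub_rev]; exact key (by omega) hy hx

theorem Bn_disjoint {N m n : ℕ} (h : m ≠ n) : Disjoint (Bn N m) (Bn N n) := by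
  have key : ∀ {m n : ℕ}, n < m → Disjoint (Bn N m) (Bn N n) := by
    intro m n h
    rw [Set.disjoint_left]
    intro x hx hy
    rw [mem_Bn] at hx hy
    have h1 := hx.1.resolve_left (by omega)
    have h2 : (2:ℝ) ^ ((n:ℝ) - 1) ≤ 2 ^ ((m:ℝ) - 2) := by
      apply Real.rpow_le_rpow_of_exponent_le (by norm_num)
      have : (n:ℝ) + 1 ≤ m := by exact_mod_cast h
      linarith
    linarith [hy.2]
  rcases lt_or_gt_of_ne h with h | h
  · exact (key h).symm
  · exact key h

theorem Bn_cover {N : ℕ} (x : Euc N) : ∃ n, x ∈ Bn N n := by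
  have hex : ∃ n : ℕ, ‖x‖ < (2:ℝ) ^ ((n:ℝ) - 1) := by
    obtain ⟨n, hn⟩ := pow_unbounded_of_one_lt ‖x‖ (one_lt_two)
    refine ⟨n + 1, ?_⟩
    push_cast
    rwa [add_sub_cancel_right, Real.rpow_natCast]
  classical
  refine ⟨Nat.find hex, mem_Bn.mpr ⟨?_, Nat.find_spec hex⟩⟩
  by_cases h : Nat.find hex = 0
  · exact Or.inl h
  · right
    have := Nat.find_min hex (Nat.sub_lt (Nat.pos_of_ne_zero h) one_pos)
    rw [not_lt, Nat.cast_sub (Nat.one_le_iff_ne_zero.mpr h)] at this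
    rw [show ((Nat.find hex : ℕ) : ℝ) - 2 = (Nat.find hex : ℕ) - ((1 : ℕ) : ℝ) - 1 by push_cast; ring]
    exact this

theorem Bn_vol (N : ℕ) : ∃ v : ℝ, 0 < v ∧ ∀ n : ℕ,
    volume (Bn N n) ≤ ENNReal.ofReal (v * 2 ^ (((n:ℝ) - 1) * N)) := by
  refine ⟨(volume (Metric.ball (0 : Euc N) 1)).toReal, ?_, fun n => ?_⟩
  · exact ENNReal.toReal_pos (Metric.measure_ball_pos _ _ one_pos).ne' measure_ball_lt_top.ne
  · have h1 : Bn N n ⊆ Metric.ball 0 ((2:ℝ) ^ ((n:ℝ) - 1)) := by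
      intro x hx
      rw [mem_ball_zero_iff]
      exact (mem_Bn.mp hx).2
    refine (measure_mono h1).trans (le_of_eq ?_)
    rw [Measure.addHaar_ball_of_pos _ _ (by positivity), ENNReal.ofReal_mul ENNReal.toReal_nonneg,
      ENNReal.ofReal_toReal measure_ball_lt_top.ne, Real.rpow_mul (by norm_num), Real.rpow_natCast, mul_comm]
    simp

theorem real_far {N m n : ℕ} {v P a δ : ℝ} (hv : 0 < v) (hP : 1 < P)
    (h1 : δ ≤ N * (1 - P⁻¹) - a) (h2 : δ ≤ a + N * P⁻¹) :
    (2:ℝ) ^ (((m:ℝ) - 1) * a) * ((((2:ℝ) ^ ((max m n : ℕ) - 3 : ℝ)) ^ N)⁻¹ *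
      ((v * 2 ^ (((n:ℝ) - 1) * N)) ^ (1 - P⁻¹) * (v * 2 ^ (((m:ℝ) - 1) * N)) ^ P⁻¹))
     ≤ v * 2 ^ (2 * N : ℝ) * (((2:ℝ) ^ (-δ)) ^ ((m:ℤ) - n).natAbs * 2 ^ (((n:ℝ) - 1) * a)) := by
  have e0 : v ^ (1 - P⁻¹) * v ^ P⁻¹ = v := by
    rw [← Real.rpow_add hv]; simp
  have e1 : (((2:ℝ) ^ ((max m n : ℕ) - 3 : ℝ)) ^ N)⁻¹ = 2 ^ (-(((max m n : ℕ) - 3 : ℝ) * N)) := by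
    rw [Real.rpow_neg (by norm_num), Real.rpow_mul (by norm_num), Real.rpow_natCast]
  have e2 : ((2:ℝ) ^ (-δ)) ^ ((m:ℤ) - n).natAbs = 2 ^ (-δ * |(m:ℝ) - n|) := by
    rw [Real.rpow_mul (by norm_num), ← Real.rpow_natCast]
    congr 1
    rw [Nat.cast_natAbs]; push_cast; rfl
  have p2 : (0:ℝ) < 2 := by norm_num
  rw [e1, e2, Real.mul_rpow hv.le (by positivity), Real.mul_rpow hv.le (by positivity),
    ← Real.rpow_mul p2.le, ← Real.rpow_mul p2.le]
  have : (2:ℝ) ^ (((m:ℝ) - 1) * a) * (2 ^ (-(((max m n : ℕ) - 3 : ℝ) * N)) *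
      (2 ^ (((n:ℝ) - 1) * N * (1 - P⁻¹)) * 2 ^ (((m:ℝ) - 1) * N * P⁻¹)))
     ≤ 2 ^ (2 * N : ℝ) * (2 ^ (-δ * |(m:ℝ) - n|) * 2 ^ (((n:ℝ) - 1) * a)) := by
    simp only [← Real.rpow_add p2]
    apply Real.rpow_le_rpow_of_exponent_le (by norm_num)
    rcases le_total n m with hnm | hnm
    · have : (n:ℝ) ≤ m := by exact_mod_cast hnm
      rw [max_eq_left hnm, abs_of_nonneg (by linarith)]
      have := mul_le_mul_of_nonneg_left h1 (by linarith : 0 ≤ (m:ℝ) - n)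
      linarith
    · have : (m:ℝ) ≤ n := by exact_mod_cast hnm
      rw [max_eq_right hnm, abs_of_nonpos (by linarith)]
      have := mul_le_mul_of_nonneg_left h2 (by linarith : 0 ≤ (n:ℝ) - m)
      linarith
  calc _ = (v ^ (1 - P⁻¹) * v ^ P⁻¹) * ((2:ℝ) ^ (((m:ℝ) - 1) * a) * (2 ^ (-(((max m n : ℕ) - 3 : ℝ) * N)) *
      (2 ^ (((n:ℝ) - 1) * N * (1 - P⁻¹)) * 2 ^ (((m:ℝ) - 1) * N * P⁻¹)))) := by ring
    _ ≤ v * (2 ^ (2 * N : ℝ) * (2 ^ (-δ * |(m:ℝ) - n|) * 2 ^ (((n:ℝ) - 1) * a))) := by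
      rw [e0]; gcongr
    _ = _ := by ring

theorem real_near {m n : ℕ} {a δ : ℝ} (hδ : 0 < δ) (h : ((m:ℤ) - n).natAbs ≤ 1) :
    (2:ℝ) ^ (((m:ℝ) - 1) * a) ≤ 2 ^ (|a| + δ) *
      (((2:ℝ) ^ (-δ)) ^ ((m:ℤ) - n).natAbs * 2 ^ (((n:ℝ) - 1) * a)) := by
  have e2 : ((2:ℝ) ^ (-δ)) ^ ((m:ℤ) - n).natAbs = 2 ^ (-δ * |(m:ℝ) - n|) := by
    rw [Real.rpow_mul (by norm_num), ← Real.rpow_natCast]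
    congr 1
    rw [Nat.cast_natAbs]; push_cast; rfl
  have p2 : (0:ℝ) < 2 := by norm_num
  rw [e2]
  simp only [← Real.rpow_add p2]
  apply Real.rpow_le_rpow_of_exponent_le (by norm_num)
  have h1 : |(m:ℝ) - n| ≤ 1 := by
    have : ((((m:ℤ) - n).natAbs : ℕ) : ℝ) ≤ 1 := by exact_mod_cast h
    rw [Nat.cast_natAbs] at this
    push_cast at this
    exact this
  have h2 : ((m:ℝ) - n) * a ≤ |a| := by
    calc _ ≤ |((m:ℝ) - n) * a| := le_abs_self _
      _ = |(m:ℝ) - n| * |a| := abs_mul _ _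
      _ ≤ 1 * |a| := by gcongr
      _ = _ := one_mul _
  nlinarith

theorem tsum_near_far (c d : ℕ → ℝ≥0∞) (m : ℕ)
    (h : ∀ n : ℕ, 2 ≤ ((m:ℤ) - n).natAbs → c n ≤ d n) :
    ∑' n, c n ≤ c (m - 1) + (c m + (c (m + 1) + ∑' n : ℕ, if 2 ≤ ((m:ℤ) - n).natAbs then d n else 0)) := by
  calc ∑' n, c n ≤ ∑' n, ((if n = m - 1 then c n else 0) + ((if n = m then c n else 0) +
        ((if n = m + 1 then c n else 0) + if 2 ≤ ((m:ℤ) - n).natAbs then d n else 0))) := by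
        refine ENNReal.tsum_le_tsum fun n => ?_
        by_cases h1 : 2 ≤ ((m:ℤ) - n).natAbs
        · refine (h n h1).trans ?_
          rw [if_pos h1]
          exact le_add_self.trans (le_add_self.trans le_add_self)
        · have : n = m - 1 ∨ n = m ∨ n = m + 1 := by omega
          rcases this with h2 | h2 | h2
          · rw [if_pos h2]; exact le_self_add
          · rw [if_pos h2]; exact le_self_add.trans le_add_self
          · rw [if_pos h2]; exact le_self_add.trans (le_add_self.trans le_add_self)
    _ = _ := by
      rw [ENNReal.tsum_add, ENNReal.tsum_add, ENNReal.tsum_add, tsum_ite_eq, tsum_ite_eq, tsum_ite_eq]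

theorem far_size {N : ℕ} (T : (Euc N → ℝ) → (Euc N → ℝ)) (C₀ : ℝ≥0∞)
    (hTsize : ∀ f : Euc N → ℝ, Measurable f → MeasureTheory.Integrable f volume →
      HasCompactSupport f →
      ∀ᵐ x ∂volume, x ∉ tsupport f →
        ENNReal.ofReal |T f x|
          ≤ C₀ * ∫⁻ y, ENNReal.ofReal |f y| / ENNReal.ofReal (‖x - y‖ ^ N) ∂volume)
    {f : Euc N → ℝ} (hf : Measurable f) {n : ℕ} (hfn : ∀ x, x ∉ Bn N n → f x = 0)
    (hint : ∫⁻ x, ENNReal.ofReal |f x| < ∞) :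
    ∀ᵐ x : Euc N ∂volume, ∀ m : ℕ, 2 ≤ ((m:ℤ) - n).natAbs → x ∈ Bn N m →
      ENNReal.ofReal |T f x| ≤ C₀ * (ENNReal.ofReal (((2:ℝ) ^ ((max m n : ℕ) - 3 : ℝ)) ^ N)⁻¹ *
        ∫⁻ y, ENNReal.ofReal |f y|) := by
  have hi : Integrable f volume := by
    refine ⟨hf.aestronglyMeasurable, ?_⟩
    rw [hasFiniteIntegral_iff_norm]
    exact hint
  have hc : HasCompactSupport f := by
    refine HasCompactSupport.intro (isCompact_closedBall (0 : Euc N) ((2:ℝ) ^ ((n:ℝ) - 1))) ?_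
    intro x hx
    apply hfn
    intro hB
    apply hx
    rw [mem_closedBall_zero_iff]
    exact (mem_Bn.mp hB).2.le
  filter_upwards [hTsize f hf hi hc] with x hx m hmn hxm
  set d : ℝ := (2:ℝ) ^ ((max m n : ℕ) - 3 : ℝ) with hd
  have hdp : 0 < d := by positivity
  have hsub : tsupport f ⊆ {y | d ≤ ‖x - y‖} := by
    refine closure_minimal ?_ (isClosed_le continuous_const (by fun_prop))
    intro y hy
    refine Bn_dist hmn hxm ?_
    by_contra hB
    exact hy (hfn y hB)
  have hxt : x ∉ tsupport f := by
    intro h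
    have := hsub h
    simp only [mem_ofPred_eq, sub_self, norm_zero] at this
    linarith
  refine (hx hxt).trans ?_
  gcongr
  rw [← lintegral_const_mul' _ _ (by finiteness)]
  refine lintegral_mono fun y => ?_
  by_cases hy : y ∈ Bn N n
  · rw [mul_comm, ENNReal.ofReal_inv_of_pos (by positivity), div_eq_mul_inv]
    gcongr
    exact Bn_dist hmn hxm hy
  · simp [hfn y hy]
/-- Let `1 < p < ∞`, `1 ≤ q, r ≤ ∞`, `−N/p < a < N/p'`.  If `T`
maps measurable functions to measurable functions, is sublinear over countable
decompositions with pairwise disjoint supports, satisfies the size condition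
`|Tf(x)| ≤ C₀ ∫ |f(y)|/|x−y|^N dy` for integrable compactly supported `f` and
a.e. `x` outside the support of `f`, and is bounded on `L^{p,r}(ℝ^N)`, then `T`
is bounded on `HL^{a,r}_{p,q}(ℝ^N)`. -/
theorem sublinear_bounded_on_lorentzHerz {N : ℕ} (hN : 1 ≤ N)
    (p q r : ℝ≥0∞) (hp1 : 1 < p) (hp : p ≠ ∞) (hq : 1 ≤ q) (hr : 1 ≤ r)
    (a : ℝ) (ha₁ : -((N : ℝ) / p.toReal) < a) (ha₂ : a < (N : ℝ) / (conjExp p).toReal)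
    (T : (Euc N → ℝ) → (Euc N → ℝ))
    (hTmeas : ∀ f : Euc N → ℝ, Measurable f → Measurable (T f))
    (hTsub : ∀ F : ℕ → Euc N → ℝ, (∀ j, Measurable (F j)) →
      (Pairwise fun i j => Disjoint (Function.support (F i)) (Function.support (F j))) →
      ∀ᵐ x ∂volume,
        ENNReal.ofReal |T (fun y => ∑' j, F j y) x| ≤ ∑' j, ENNReal.ofReal |T (F j) x|)
    (C₀ : ℝ≥0∞) (hC₀ : C₀ < ∞)
    (hTsize : ∀ f : Euc N → ℝ, Measurable f → MeasureTheory.Integrable f volume →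
      HasCompactSupport f →
      ∀ᵐ x ∂volume, x ∉ tsupport f →
        ENNReal.ofReal |T f x|
          ≤ C₀ * ∫⁻ y, ENNReal.ofReal |f y| / ENNReal.ofReal (‖x - y‖ ^ N) ∂volume)
    (C₁ : ℝ≥0∞) (hC₁ : C₁ < ∞)
    (hTbdd : ∀ f : Euc N → ℝ, Measurable f → lorentzNorm volume p r f < ∞ →
      lorentzNorm volume p r (T f) ≤ C₁ * lorentzNorm volume p r f) :
    ∃ C : ℝ≥0∞, C < ∞ ∧ ∀ f : Euc N → ℝ, Measurable f →
      herzNorm volume (Set.univ : Set (Euc N)) a p q r f < ∞ →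
      herzNorm volume (Set.univ : Set (Euc N)) a p q r (T f)
        ≤ C * herzNorm volume (Set.univ : Set (Euc N)) a p q r f := by
  have hP : 1 < p.toReal := by
    rw [← ENNReal.toReal_one]; exact ENNReal.toReal_strict_mono hp hp1
  have hP0 : 0 < p.toReal := by linarith
  have hconj : (N : ℝ) / (conjExp p).toReal = N * (1 - p.toReal⁻¹) := by
    have : 0 < p.toReal - 1 := by linarith
    rw [conjExp, if_neg hp1.ne', if_neg hp, ENNReal.toReal_ofReal (by positivity)]
    field_simp
  rw [hconj] at ha₂
  rw [div_eq_mul_inv] at ha₁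
  obtain ⟨Ks, hKs, hstep⟩ := lorentzNormOf_step (p := p) hP.le hr
  obtain ⟨Ke, hKe, hemb⟩ := lint_le_lorentz (p := p) hP hr
  obtain ⟨v, hv, hvol⟩ := Bn_vol N
  set P := p.toReal
  set δ : ℝ := min (N * (1 - P⁻¹) - a) (a + N * P⁻¹) with hδ
  have hδ0 : 0 < δ := lt_min (by linarith) (by linarith)
  obtain ⟨S, hS, hrow, hcol⟩ := geom_kernel (ρ := (2:ℝ) ^ (-δ)) (by positivity)
    (Real.rpow_lt_one_of_one_lt_of_neg (by norm_num) (by linarith))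
  set k : ℕ → ℕ → ℝ≥0∞ := fun m n => ENNReal.ofReal (((2:ℝ) ^ (-δ)) ^ ((m:ℤ) - n).natAbs) with hk
  set w : ℕ → ℝ≥0∞ := fun n => ENNReal.ofReal ((2 : ℝ) ^ (((n : ℝ) - 1) * a)) with hw
  set cn : ℝ≥0∞ := ENNReal.ofReal (2 ^ (|a| + δ)) with hcn
  set cf : ℝ≥0∞ := ENNReal.ofReal (v * 2 ^ (2 * N : ℝ)) with hcf
  set V : ℕ → ℝ := fun n => v * 2 ^ (((n:ℝ) - 1) * N) with hV
  have hVp : ∀ n, 0 < V n := fun n => by simp only [hV]; positivity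
  refine ⟨64 * (3 * (C₁ * cn) + Ks * (C₀ * (Ke * cf))) * S, by finiteness, ?_⟩
  intro f hf hfin
  rw [herzNorm_eq] at hfin
  rw [herzNorm_eq, herzNorm_eq]
  set fn : ℕ → Euc N → ℝ := fun n => (Bn N n).indicator f with hfn
  set L : ℕ → ℝ≥0∞ := fun n => lorentzNorm volume p r (fn n) with hL
  have hw0 : ∀ n, w n ≠ 0 := fun n => by
    simp only [hw]
    have : 0 < ENNReal.ofReal ((2 : ℝ) ^ (((n : ℝ) - 1) * a)) := by
      rw [ENNReal.ofReal_pos]; positivity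
    exact this.ne'
  have hLfin : ∀ n, L n < ∞ := by
    intro n
    have h1 : w n * L n < ∞ := lqn_term_lt_top hq hfin n
    rcases ENNReal.mul_lt_top_iff.mp h1 with h | h | h
    · exact h.2
    · exact absurd h (hw0 n)
    · rw [h]; simp
  have hfm : ∀ n, Measurable (fn n) := fun n => hf.indicator (Bn_meas N n)
  have hf0 : ∀ n x, x ∉ Bn N n → fn n x = 0 := fun n x hx => indicator_of_notMem hx _
  have hfint : ∀ n, ∫⁻ x, ENNReal.ofReal |fn n x| ≤ Ke * (ENNReal.ofReal (V n ^ (1 - P⁻¹)) * L n) :=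
    fun n => hemb (Euc N) volume (fn n) (hfm n) (Bn N n) (hf0 n) (V n) (hVp n) (hvol n) (hLfin n)
  have hfint' : ∀ n, ∫⁻ x, ENNReal.ofReal |fn n x| < ∞ := fun n =>
    lt_of_le_of_lt (hfint n) (by have := hLfin n; finiteness)
  have hsum : (fun y => ∑' j, fn j y) = f := by
    funext y
    obtain ⟨n, hn⟩ := Bn_cover y
    rw [tsum_eq_single n]
    · exact indicator_of_mem hn _
    · intro m hm
      exact hf0 m y fun h => Set.disjoint_left.mp (Bn_disjoint hm) h hn
  have hsub := hTsub fn hfm (fun i j hij => (Bn_disjoint (N := N) hij).mono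
    (Function.support_subset_iff'.mpr (hf0 i)) (Function.support_subset_iff'.mpr (hf0 j)))
  rw [hsum] at hsub
  have hfar : ∀ᵐ x : Euc N ∂volume, ∀ n : ℕ, ∀ m : ℕ, 2 ≤ ((m:ℤ) - n).natAbs → x ∈ Bn N m →
      ENNReal.ofReal |T (fn n) x| ≤ C₀ * (ENNReal.ofReal (((2:ℝ) ^ ((max m n : ℕ) - 3 : ℝ)) ^ N)⁻¹ *
        ∫⁻ y, ENNReal.ofReal |fn n y|) :=
    ae_all_iff.mpr fun n => far_size T C₀ hTsize (hfm n) (hf0 n) (hfint' n)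
  refine schur_lq hq k S _ hrow hcol _ _ fun m => ?_
  change w m * lorentzNorm volume p r ((Bn N m).indicator (T f)) ≤ _ * ∑' n, k m n * (w n * L n)
  set D : ℕ → ℝ≥0∞ := fun n => C₀ * (ENNReal.ofReal (((2:ℝ) ^ ((max m n : ℕ) - 3 : ℝ)) ^ N)⁻¹ *
        (Ke * (ENNReal.ofReal (V n ^ (1 - P⁻¹)) * L n))) with hD
  set G : ℝ≥0∞ := ∑' n : ℕ, if 2 ≤ ((m:ℤ) - n).natAbs then D n else 0 with hG
  set LE : (Euc N → ℝ≥0∞) → ℝ≥0∞ := fun F => lorentzNormOf (rearrE volume F) p r with hLE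
  set H : ℕ → Euc N → ℝ≥0∞ := fun n x => ENNReal.ofReal |T (fn n) x| with hH
  have hTn : ∀ n, LE (H n) ≤ C₁ * L n := fun n => hTbdd (fn n) (hfm n) (hLfin n)
  have hpt : ∀ᵐ x : Euc N ∂volume, ENNReal.ofReal |(Bn N m).indicator (T f) x| ≤
      H (m - 1) x + (H m x + (H (m + 1) x + (Bn N m).indicator (fun _ => G) x)) := by
    filter_upwards [hsub, hfar] with x h1 h2
    by_cases hx : x ∈ Bn N m
    · rw [indicator_of_mem hx, indicator_of_mem hx]
      refine h1.trans (tsum_near_far (fun n => H n x) D m fun n hn => ?_)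
      refine (h2 n m hn hx).trans ?_
      simp only [hD]
      gcongr
      exact hfint n
    · rw [indicator_of_notMem hx]; simp
  have hLG : LE ((Bn N m).indicator fun _ => G) ≤ Ks * (ENNReal.ofReal (V m ^ P⁻¹) * G) :=
    (lorentzNormOf_mono p r fun t _ => rearrE_const volume (Bn N m) G (hvol m) t).trans
      (hstep G (V m) (hVp m))
  have hmain : lorentzNorm volume p r ((Bn N m).indicator (T f)) ≤
      64 * (C₁ * L (m - 1) + (C₁ * L m + (C₁ * L (m + 1) + Ks * (ENNReal.ofReal (V m ^ P⁻¹) * G)))) := by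
    calc _ ≤ LE (fun x => H (m - 1) x + (H m x + (H (m + 1) x + (Bn N m).indicator (fun _ => G) x))) :=
          lorentzNormOf_mono p r fun t _ => rearrE_mono hpt t
      _ ≤ 4 * (LE (H (m - 1)) + LE (fun x => H m x + (H (m + 1) x + (Bn N m).indicator (fun _ => G) x))) :=
          lorentzE_add volume _ _ hP.le hr
      _ ≤ 4 * (LE (H (m - 1)) + 4 * (LE (H m) + LE (fun x => H (m + 1) x + (Bn N m).indicator (fun _ => G) x))) := by
          gcongr
          exact lorentzE_add volume _ _ hP.le hr
      _ ≤ 4 * (LE (H (m - 1)) + 4 * (LE (H m) + 4 * (LE (H (m + 1)) + LE ((Bn N m).indicator (fun _ => G))))) := by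
          gcongr
          exact lorentzE_add volume _ _ hP.le hr
      _ ≤ 4 * (16 * LE (H (m - 1)) + 4 * (4 * LE (H m) + 4 * (LE (H (m + 1)) + LE ((Bn N m).indicator (fun _ => G))))) := by
          gcongr
          · exact le_mul_of_one_le_left zero_le (by norm_num)
          · exact le_mul_of_one_le_left zero_le (by norm_num)
      _ = 64 * (LE (H (m - 1)) + (LE (H m) + (LE (H (m + 1)) + LE ((Bn N m).indicator (fun _ => G))))) := by
          ring
      _ ≤ _ := by
          gcongr
          · exact hTn _
          · exact hTn _
          · exact hTn _
  set Z : ℝ≥0∞ := ∑' n, k m n * (w n * L n) with hZ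
  have hnear : ∀ n : ℕ, ((m:ℤ) - n).natAbs ≤ 1 → w m * (C₁ * L n) ≤ C₁ * cn * Z := by
    intro n hn
    have h1 : w m ≤ cn * (k m n * w n) := by
      simp only [hw, hcn, hk]
      rw [← ENNReal.ofReal_mul (by positivity), ← ENNReal.ofReal_mul (by positivity)]
      exact ENNReal.ofReal_le_ofReal (real_near hδ0 hn)
    calc w m * (C₁ * L n) ≤ cn * (k m n * w n) * (C₁ * L n) := by gcongr
      _ = C₁ * cn * (k m n * (w n * L n)) := by ring
      _ ≤ _ := by
        gcongr
        exact ENNReal.le_tsum (f := fun n => k m n * (w n * L n)) n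
  have hfarZ : w m * (Ks * (ENNReal.ofReal (V m ^ P⁻¹) * G)) ≤ Ks * (C₀ * (Ke * cf)) * Z := by
    have h1 : ∀ n : ℕ, w m * (ENNReal.ofReal (V m ^ P⁻¹) * D n) ≤ C₀ * (Ke * cf) * (k m n * (w n * L n)) := by
      intro n
      have h2 : w m * (ENNReal.ofReal (((2:ℝ) ^ ((max m n : ℕ) - 3 : ℝ)) ^ N)⁻¹ *
          (ENNReal.ofReal (V n ^ (1 - P⁻¹)) * ENNReal.ofReal (V m ^ P⁻¹))) ≤ cf * (k m n * w n) := by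
        simp only [hw, hcf, hk]
        have q1 := (hVp n).le
        have q2 := (hVp m).le
        rw [← ENNReal.ofReal_mul (by positivity), ← ENNReal.ofReal_mul (by positivity),
          ← ENNReal.ofReal_mul (by positivity), ← ENNReal.ofReal_mul (by positivity),
          ← ENNReal.ofReal_mul (by positivity)]
        exact ENNReal.ofReal_le_ofReal (real_far hv hP (min_le_left _ _) (min_le_right _ _))
      calc _ = C₀ * Ke * L n * (w m * (ENNReal.ofReal (((2:ℝ) ^ ((max m n : ℕ) - 3 : ℝ)) ^ N)⁻¹ *
          (ENNReal.ofReal (V n ^ (1 - P⁻¹)) * ENNReal.ofReal (V m ^ P⁻¹)))) := by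
            simp only [hD]; ring
        _ ≤ C₀ * Ke * L n * (cf * (k m n * w n)) := by gcongr
        _ = _ := by ring
    calc w m * (Ks * (ENNReal.ofReal (V m ^ P⁻¹) * G))
        ≤ w m * (Ks * (ENNReal.ofReal (V m ^ P⁻¹) * ∑' n, D n)) := by
          gcongr
          rw [hG]
          refine ENNReal.tsum_le_tsum fun n => ?_
          split_ifs
          · exact le_rfl
          · exact zero_le
      _ = Ks * ∑' n, w m * (ENNReal.ofReal (V m ^ P⁻¹) * D n) := by
          rw [ENNReal.tsum_mul_left (f := fun n => ENNReal.ofReal (V m ^ P⁻¹) * D n),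
            ENNReal.tsum_mul_left (f := D)]
          generalize ∑' n, D n = E
          ring
      _ ≤ Ks * ∑' n, C₀ * (Ke * cf) * (k m n * (w n * L n)) := by
          exact mul_le_mul_right (ENNReal.tsum_le_tsum h1) Ks
      _ = _ := by
          rw [ENNReal.tsum_mul_left]; ring
  calc w m * lorentzNorm volume p r ((Bn N m).indicator (T f))
      ≤ w m * (64 * (C₁ * L (m - 1) + (C₁ * L m + (C₁ * L (m + 1) + Ks * (ENNReal.ofReal (V m ^ P⁻¹) * G))))) := by
        gcongr
    _ = 64 * (w m * (C₁ * L (m - 1)) + (w m * (C₁ * L m) + (w m * (C₁ * L (m + 1)) +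
          w m * (Ks * (ENNReal.ofReal (V m ^ P⁻¹) * G))))) := by ring
    _ ≤ 64 * (C₁ * cn * Z + (C₁ * cn * Z + (C₁ * cn * Z + Ks * (C₀ * (Ke * cf)) * Z))) := by
        exact mul_le_mul_right (add_le_add (hnear (m - 1) (by omega)) (add_le_add (hnear m (by omega))
          (add_le_add (hnear (m + 1) (by push_cast; omega)) hfarZ))) 64
    _ = _ := by ring
end
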